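/- arXiv:1904.03984 — 3 statements merged into one kernel-verified Lean document; each statement's English description precedes it below -/
import Mathlib

section
/- Let d ≥ 2 be an integer and let ω₁, …, ω_d be concave moduli of continuity with ω₁(t)·…·ω_d(t) = t·ω(t), where lim_{t→0⁺} ω(t) = 0 and ω(t₁t₂) ≤ C·ω(t₁)·ω(t₂) for some constant C > 0 and all t₁, t₂ ∈ [0,1]. Suppose that ω₁, …, ω_d together with all moduli of Hölder continuity t ↦ t^α (0 < α < 1) form a comparable family of moduli of continuity. If f₁, …, f_d are pairwise commuting orientation-preserving circle diffeomorphisms such that f_k is of class C^{1+ω_k} for each k, and the rotation numbers of f₁, …, f_d are independent over the rationals, then f₁, …, f_d are simultaneously topologically conjugate to rigid rotations. -/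
open Filter Set

/-- A modulus of continuity: a continuous, strictly increasing function on `[0,1]`
with value `0` at `0` (hence nonnegative). -/
def IsModulus (ω : ℝ → ℝ) : Prop :=
  ContinuousOn ω (Icc 0 1) ∧ StrictMonoOn ω (Icc 0 1) ∧ ω 0 = 0 ∧
    ∀ t ∈ Icc (0 : ℝ) 1, 0 ≤ ω t

/-- A concave modulus of continuity. -/
def IsConcaveModulus (ω : ℝ → ℝ) : Prop :=
  IsModulus ω ∧ ConcaveOn ℝ (Icc 0 1) ω

/-- `f` (viewed as data on the circle `ℝ/ℤ`, represented by a function on `ℝ`)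
is `ω`-continuous: `sup |f x - f y| / ω |x - y| < ∞`. -/
def OmegaCont (ω f : ℝ → ℝ) : Prop :=
  ∃ K : ℝ, ∀ x y : ℝ, |x - y| ≤ 1 → |f x - f y| ≤ K * ω |x - y|

/-- `f : ℝ → ℝ` is the lift of an orientation-preserving `C¹` circle diffeomorphism. -/
def IsCircleDiffeoLift (f : ℝ → ℝ) : Prop :=
  StrictMono f ∧ (∀ x, f (x + 1) = f x + 1) ∧ ContDiff ℝ 1 f ∧ ∀ x, 0 < deriv f x

/-- `α` is the rotation number of the circle map with lift `f`. -/
def HasRotationNumber (f : ℝ → ℝ) (α : ℝ) : Prop :=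
  Tendsto (fun n : ℕ => f^[n] 0 / n) atTop (nhds α)

/-- `1, α 0, …, α (d-1)` are linearly independent over `ℚ`, i.e. the classes of the
`α k` in `ℝ/ℤ` are independent over the rationals. -/
def RatIndep {d : ℕ} (α : Fin d → ℝ) : Prop :=
  ∀ (q : Fin d → ℚ) (q₀ : ℚ), (q₀ : ℝ) + ∑ k, (q k : ℝ) * α k = 0 →
    q₀ = 0 ∧ ∀ k, q k = 0

/-- Lift of an (orientation-preserving) circle homeomorphism. -/
def IsCircleHomeoLift (h : ℝ → ℝ) : Prop :=
  Continuous h ∧ StrictMono h ∧ ∀ x, h (x + 1) = h x + 1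

/-- The circle maps with lifts `f k` are simultaneously topologically conjugate to
rigid rotations: a single circle homeomorphism conjugates each `f k` to a rotation. -/
def SimultaneouslyConjToRotations {d : ℕ} (f : Fin d → ℝ → ℝ) : Prop :=
  ∃ h : ℝ → ℝ, IsCircleHomeoLift h ∧ ∀ k, ∃ β : ℝ, ∀ x, h (f k x) = h x + β

/-- The family consisting of the `ωs k` together with all moduli of Hölder continuity
`t ↦ t ^ a`, `a ∈ (0,1)`, is a comparable family of moduli of continuity. -/
def ComparableWithHolder {d : ℕ} (ωs : Fin d → ℝ → ℝ) : Prop :=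
  ∃ δ > (0 : ℝ),
    (∀ i j : Fin d, (∀ x ∈ Ioo (0 : ℝ) δ, ωs i x ≤ ωs j x) ∨
      (∀ x ∈ Ioo (0 : ℝ) δ, ωs j x ≤ ωs i x)) ∧
    (∀ (i : Fin d), ∀ a ∈ Ioo (0 : ℝ) 1,
      (∀ x ∈ Ioo (0 : ℝ) δ, ωs i x ≤ x ^ a) ∨ (∀ x ∈ Ioo (0 : ℝ) δ, x ^ a ≤ ωs i x))

open Function in
/-- `CostReach c v t`: the lattice point `v` can be reached from the origin by a path of positive
unit steps of total cost at most `t`, where a step in direction `k` from `u` costs `c k u`. -/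
inductive CostReach {ι : Type*} [DecidableEq ι] (c : ι → (ι → ℕ) → ℝ) : (ι → ℕ) → ℝ → Prop
  | zero : CostReach c 0 0
  | step {v : ι → ℕ} {t : ℝ} (k : ι) :
      CostReach c v t → CostReach c (update v k (v k + 1)) (t + c k v)
  | mono {v : ι → ℕ} {t t' : ℝ} : t ≤ t' → CostReach c v t → CostReach c v t'

section Lattice

open Function

variable {ι : Type*} [DecidableEq ι] {c : ι → (ι → ℕ) → ℝ}

theorem CostReach.line {v : ι → ℕ} {t : ℝ} (h : CostReach c v t) (k : ι) (n : ℕ) :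
    CostReach c (update v k (v k + n))
      (t + ∑ j ∈ Finset.range n, c k (update v k (v k + j))) := by
  induction n with
  | zero => simpa using h
  | succ n ih =>
    have := CostReach.step k ih
    rw [Finset.sum_range_succ, ← add_assoc]
    simpa [add_assoc] using this

theorem CostReach.line_of_le (hc : ∀ k v, 0 ≤ c k v) {w : ι → ℕ} {k : ι} {x Y : ℕ} {t : ℝ}
    (h : CostReach c (update w k x) t) (hx : x ≤ w k) (hY : w k ≤ Y) :
    CostReach c w (t + ∑ j ∈ Finset.range Y, c k (update w k j)) := by
  have h1 := h.line k (w k - x)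
  simp only [update_self, update_idem] at h1
  rw [Nat.add_sub_cancel' hx, update_eq_self] at h1
  refine h1.mono (add_le_add le_rfl ?_)
  rw [← Finset.sum_image (g := fun j => x + j) (f := fun j => c k (update w k j))
    (by intro a _ b _ hab; simpa using hab)]
  refine Finset.sum_le_sum_of_subset_of_nonneg ?_ fun _ _ _ => hc _ _
  intro j hj
  simp only [Finset.mem_image, Finset.mem_range] at hj ⊢
  omega

variable [Fintype ι]

theorem sum_piFinset_update (A : ι → Finset ℕ) (k : ι) (T : Finset ℕ) (G : (ι → ℕ) → ℝ) :
    ∑ w ∈ Fintype.piFinset (update A k T), ∑ x ∈ A k, G (update w k x) =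
      T.card * ∑ v ∈ Fintype.piFinset A, G v := by
  rw [← nsmul_eq_mul, ← Finset.sum_const, ← Finset.sum_product', ← Finset.sum_product']
  refine Finset.sum_bij' (fun p _ => (p.1 k, update p.1 k p.2))
    (fun q _ => (update q.2 k q.1, q.2 k)) ?_ ?_ ?_ ?_ ?_
  · rintro ⟨w, x⟩ h
    simp only [Finset.mem_product, Fintype.mem_piFinset] at h ⊢
    refine ⟨by simpa using h.1 k, fun i => ?_⟩
    rcases eq_or_ne i k with rfl | hi
    · simpa using h.2
    · simpa [hi] using h.1 i
  · rintro ⟨t, v⟩ h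
    simp only [Finset.mem_product, Fintype.mem_piFinset] at h ⊢
    refine ⟨fun i => ?_, h.2 k⟩
    rcases eq_or_ne i k with rfl | hi
    · simpa using h.1
    · simpa [hi] using h.2 i
  · rintro ⟨w, x⟩ _
    simp
  · rintro ⟨t, v⟩ _
    simp
  · rintro ⟨w, x⟩ _
    simp

theorem card_piFinset_update (A : ι → Finset ℕ) (k : ι) (T : Finset ℕ) :
    ((Fintype.piFinset (update A k T)).card * (A k).card : ℝ) =
      T.card * (Fintype.piFinset A).card := by
  simpa using sum_piFinset_update A k T fun _ => 1

theorem sum_rpow_le {α : Type*} (s : Finset α) {ℓ : α → ℝ} (hℓ : ∀ v, 0 ≤ ℓ v) {M τ L : ℝ}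
    (hM : ∑ v ∈ s, ℓ v ≤ M) (hτ0 : 0 < τ) (hτ1 : τ ≤ 1) (hL : 0 < L)
    (hLs : L ≤ s.card) :
    ∑ v ∈ s, ℓ v ^ τ ≤ (1 + M) * s.card * L ^ (-τ) := by
  have key : ∀ v, ℓ v ^ τ ≤ L ^ (-τ) + L * L ^ (-τ) * ℓ v := by
    intro v
    have hp := Real.rpow_pos_of_pos hL (-τ)
    rcases le_total (ℓ v) L⁻¹ with h | h
    · have h1 := Real.rpow_le_rpow (hℓ v) h hτ0.le
      rw [Real.inv_rpow hL.le, ← Real.rpow_neg hL.le] at h1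
      have := mul_nonneg (mul_nonneg hL.le hp.le) (hℓ v)
      linarith
    · have hv : 0 < ℓ v := lt_of_lt_of_le (inv_pos.2 hL) h
      have h1 : ℓ v ^ (τ - 1) ≤ L⁻¹ ^ (τ - 1) :=
        Real.rpow_le_rpow_of_nonpos (inv_pos.2 hL) h (by linarith)
      rw [Real.inv_rpow hL.le, ← Real.rpow_neg hL.le] at h1
      have h2 : L ^ (-(τ - 1)) = L * L ^ (-τ) := by
        rw [neg_sub, sub_eq_add_neg, Real.rpow_add hL, Real.rpow_one]
      have h3 : ℓ v ^ τ = ℓ v ^ (τ - 1) * ℓ v := by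
        rw [← Real.rpow_add_one hv.ne']; simp
      rw [h3]
      have := mul_le_mul_of_nonneg_right (h1.trans_eq h2) hv.le
      linarith
  calc ∑ v ∈ s, ℓ v ^ τ ≤ ∑ v ∈ s, (L ^ (-τ) + L * L ^ (-τ) * ℓ v) :=
        Finset.sum_le_sum fun v _ => key v
    _ = L ^ (-τ) * (s.card + L * ∑ v ∈ s, ℓ v) := by
        rw [Finset.sum_add_distrib, ← Finset.mul_sum]; simp; ring
    _ ≤ L ^ (-τ) * (s.card + s.card * M) := by
        gcongr
        exact Finset.sum_nonneg fun v _ => hℓ v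
    _ = _ := by ring

/-- Average over a box of the cost of a full line in direction `k`. -/
theorem sum_line_le {ℓ : (ι → ℕ) → ℝ} (hℓ : ∀ v, 0 ≤ ℓ v) {M τ L : ℝ}
    (hM : ∀ s : Finset (ι → ℕ), ∑ v ∈ s, ℓ v ≤ M) (hτ0 : 0 < τ) (hτ1 : τ ≤ 1)
    (hL : 0 < L) (A : ι → Finset ℕ) (k : ι) (hA : (A k).Nonempty) (Y : ℕ)
    (hAY : (A k).card ≤ Y) (hLA : L ≤ (Fintype.piFinset A).card) :
    ∑ w ∈ Fintype.piFinset A, ∑ x ∈ Finset.range Y, ℓ (update w k x) ^ τ ≤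
      (Fintype.piFinset A).card * ((1 + M) * Y * L ^ (-τ)) := by
  have h1 := sum_piFinset_update (update A k (Finset.range Y)) k (A k) fun v => ℓ v ^ τ
  have h2 := card_piFinset_update A k (Finset.range Y)
  simp only [update_idem, update_eq_self, update_self, Finset.card_range] at h1 h2
  rw [h1]
  have hA' : (0 : ℝ) < (A k).card := by exact_mod_cast hA.card_pos
  have hAY' : ((A k).card : ℝ) ≤ Y := by exact_mod_cast hAY
  have hcard : ((Fintype.piFinset A).card : ℝ) ≤
      (Fintype.piFinset (update A k (Finset.range Y))).card := by
    refine le_of_mul_le_mul_right ?_ hA'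
    rw [h2, mul_comm]
    gcongr
  have h3 := sum_rpow_le (Fintype.piFinset (update A k (Finset.range Y))) hℓ (hM _)
    hτ0 hτ1 hL (hLA.trans hcard)
  calc _ ≤ ((A k).card : ℝ) *
        ((1 + M) * (Fintype.piFinset (update A k (Finset.range Y))).card * L ^ (-τ)) := by gcongr
    _ = (1 + M) * L ^ (-τ) *
        ((Fintype.piFinset (update A k (Finset.range Y))).card * (A k).card) := by ring
    _ = _ := by rw [h2]; ring

/-- Every point of the box `∏ A i` is reached with cost at most `m`, where `m` has average
at most `κ` over the box. -/
def AvgReach (c : ι → (ι → ℕ) → ℝ) (A : ι → Finset ℕ) (κ : ℝ) : Prop :=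
  ∃ m : (ι → ℕ) → ℝ, (∀ v ∈ Fintype.piFinset A, CostReach c v (m v)) ∧
    ∑ v ∈ Fintype.piFinset A, m v ≤ (Fintype.piFinset A).card * κ

theorem AvgReach.update {ℓ : (ι → ℕ) → ℝ} (hℓ : ∀ v, 0 ≤ ℓ v) {τ : ι → ℝ} {M L κ : ℝ}
    (hM : ∀ s : Finset (ι → ℕ), ∑ v ∈ s, ℓ v ≤ M) (hτ0 : ∀ k, 0 < τ k) (hτ1 : ∀ k, τ k ≤ 1)
    (hL : 0 < L) {A : ι → Finset ℕ} (h : AvgReach (fun k v => ℓ v ^ τ k) A κ)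
    (k : ι) (hA : (A k).Nonempty) {T : Finset ℕ} (hT : T.Nonempty) {Y : ℕ}
    (hTY : ∀ y ∈ T, y < Y) (hAT : ∀ x ∈ A k, ∀ y ∈ T, x ≤ y) (hTA : (A k).card ≤ T.card)
    (hLA : L ≤ (Fintype.piFinset A).card) :
    AvgReach (fun k v => ℓ v ^ τ k) (update A k T) (κ + (1 + M) * Y * L ^ (-τ k)) := by
  obtain ⟨m, hm, hmκ⟩ := h
  have hA' : (0 : ℝ) < (A k).card := by exact_mod_cast hA.card_pos
  refine ⟨fun w => (∑ x ∈ A k, m (Function.update w k x)) / (A k).card +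
    ∑ x ∈ Finset.range Y, ℓ (Function.update w k x) ^ τ k, ?_, ?_⟩
  · intro w hw
    rw [Fintype.mem_piFinset] at hw
    obtain ⟨x, hx, hxm⟩ := Finset.exists_le_of_sum_le hA
      (f := fun x => m (Function.update w k x))
      (g := fun _ => (∑ x ∈ A k, m (Function.update w k x)) / (A k).card) (by
        rw [Finset.sum_const, nsmul_eq_mul, mul_div_cancel₀ _ hA'.ne'])
    have hwk : w k ∈ T := by simpa using hw k
    have hr : CostReach (fun k v => ℓ v ^ τ k) (Function.update w k x)
        (m (Function.update w k x)) := by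
      apply hm
      rw [Fintype.mem_piFinset]
      intro i
      rcases eq_or_ne i k with rfl | hi
      · simpa using hx
      · simpa [hi] using hw i
    exact (hr.mono hxm).line_of_le (fun k v => Real.rpow_nonneg (hℓ v) _) (hAT x hx _ hwk)
      (hTY _ hwk).le
  · have h2 := card_piFinset_update A k T
    have hTA' : ((A k).card : ℝ) ≤ T.card := by exact_mod_cast hTA
    have hcard : ((Fintype.piFinset A).card : ℝ) ≤
        (Fintype.piFinset (Function.update A k T)).card := by
      refine le_of_mul_le_mul_right ?_ hA'
      rw [h2, mul_comm]
      gcongr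
    have hcT : T.card ≤ Y := by
      have : T ⊆ Finset.range Y := fun y hy => Finset.mem_range.2 (hTY y hy)
      simpa using Finset.card_le_card this
    have h3 := sum_line_le hℓ hM (hτ0 k) (hτ1 k) hL (Function.update A k T) k (by simpa using hT)
      Y (by simpa using hcT) (hLA.trans hcard)
    rw [Finset.sum_add_distrib, ← Finset.sum_div, sum_piFinset_update, mul_add]
    refine add_le_add ?_ h3
    rw [div_le_iff₀ hA', mul_right_comm, h2, mul_assoc]
    gcongr

theorem exists_nat_exponents {κ : Type*} [Fintype κ] {τ : κ → ℝ} (hτ0 : ∀ k, 0 < τ k) (hτ : 1 < ∑ k, τ k) :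
    ∃ s : κ → ℕ, (∀ k, 1 ≤ s k) ∧ ∀ k, (s k : ℝ) < τ k * ∑ i, (s i : ℝ) := by
  set T := ∑ k, τ k
  have hev : ∀ᶠ n : ℕ in atTop, ∀ k, 1 < n * (τ k * (T - 1)) := by
    rw [eventually_all]
    intro k
    exact (tendsto_natCast_atTop_atTop.atTop_mul_const
      (mul_pos (hτ0 k) (sub_pos.2 hτ))).eventually_gt_atTop 1
  obtain ⟨n, hn, hn0⟩ := (hev.and (eventually_gt_atTop 0)).exists
  have hn0' : (0 : ℝ) < n := by exact_mod_cast hn0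
  refine ⟨fun k => ⌈n * τ k⌉₊, fun k => Nat.ceil_pos.2 (mul_pos hn0' (hτ0 k)), fun k => ?_⟩
  have h1 := Nat.ceil_lt_add_one (mul_pos hn0' (hτ0 k)).le
  have h2 : n * T ≤ ∑ i, (⌈n * τ i⌉₊ : ℝ) := by
    rw [Finset.mul_sum]
    exact Finset.sum_le_sum fun i _ => Nat.le_ceil _
  have h3 := mul_le_mul_of_nonneg_left h2 (hτ0 k).le
  have := hn k
  simp only
  nlinarith

/-- If `∑ τ k > 1` and `ℓ` is summable, there are points reachable at a uniformly bounded cost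
which form arbitrarily long segments in the direction `k₀`. -/
theorem exists_long_segment {ℓ : (ι → ℕ) → ℝ} (hℓ : ∀ v, 0 ≤ ℓ v) {τ : ι → ℝ} {M : ℝ}
    (hM : ∀ s : Finset (ι → ℕ), ∑ v ∈ s, ℓ v ≤ M) (hτ0 : ∀ k, 0 < τ k) (hτ1 : ∀ k, τ k ≤ 1)
    (hτ : 1 < ∑ k, τ k) (k₀ : ι) :
    ∃ K : ℝ, ∀ N : ℕ, ∃ u : ι → ℕ, ∀ j ≤ N,
      CostReach (fun k v => ℓ v ^ τ k) (update u k₀ (u k₀ + j)) K := by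
  obtain ⟨s, hs1, hs⟩ := exists_nat_exponents hτ0 hτ
  have hM0 : 0 ≤ M := by simpa using hM ∅
  let box : ℕ → ι → Finset ℕ := fun n k => Finset.Ico (2 ^ (n * s k) - 1) (2 ^ (n * s k + 1) - 1)
  let L : ℕ → ℝ := fun n => ∏ k, (2 : ℝ) ^ (n * s k)
  let cost : ℕ → ι → ℝ := fun n k =>
    (1 + M) * ((2 ^ ((n + 1) * s k + 1) : ℕ) : ℝ) * L n ^ (-τ k)
  have hL : ∀ n, 0 < L n := fun n => Finset.prod_pos fun k _ => by positivity
  have hcost0 : ∀ n k, 0 ≤ cost n k := fun n k => by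
    have := Real.rpow_pos_of_pos (hL n) (-τ k)
    positivity
  have hbox : ∀ n k, (box n k).card = 2 ^ (n * s k) := fun n k => by
    have := Nat.one_le_two_pow (n := n * s k)
    simp only [box, Nat.card_Ico, pow_succ]
    omega
  have hne : ∀ n k, (box n k).Nonempty := fun n k => by
    rw [← Finset.card_pos, hbox]; positivity
  have hpow : ∀ n k, n * s k + 1 ≤ (n + 1) * s k := fun n k => by
    have := hs1 k; rw [add_mul]; omega
  have hpow2 : ∀ n k, 2 ^ (n * s k + 1) ≤ 2 ^ ((n + 1) * s k) := fun n k =>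
    Nat.pow_le_pow_right (by norm_num) (hpow n k)
  have hLcard : ∀ n (A : ι → Finset ℕ), (∀ k, 2 ^ (n * s k) ≤ (A k).card) →
      L n ≤ (Fintype.piFinset A).card := by
    intro n A h
    rw [Fintype.card_piFinset]
    push_cast
    exact Finset.prod_le_prod (fun k _ => by positivity) fun k _ => by exact_mod_cast h k
  have hstep : ∀ n κ, AvgReach (fun k v => ℓ v ^ τ k) (box n) κ → ∀ D : Finset ι,
      AvgReach (fun k v => ℓ v ^ τ k) (D.piecewise (box (n + 1)) (box n))
        (κ + ∑ k ∈ D, cost n k) := by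
    intro n κ h D
    induction D using Finset.induction_on with
    | empty => simpa using h
    | insert k D hk ih =>
      rw [Finset.piecewise_insert, Finset.sum_insert hk, add_comm (cost n k), ← add_assoc]
      have hk' : D.piecewise (box (n + 1)) (box n) k = box n k :=
        Finset.piecewise_eq_of_notMem _ _ _ hk
      refine AvgReach.update hℓ hM hτ0 hτ1 (hL n) ih k (by rw [hk']; exact hne n k)
        (hne (n + 1) k) ?_ ?_ ?_ ?_
      · intro y hy
        simp only [box, Finset.mem_Ico] at hy
        omega
      · rw [hk']
        intro x hx y hy
        simp only [box, Finset.mem_Ico] at hx hy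
        have := hpow2 n k
        omega
      · rw [hk', hbox, hbox]
        exact (Nat.pow_le_pow_right (by norm_num) (Nat.le_succ _)).trans (hpow2 n k)
      · refine hLcard n _ fun i => ?_
        by_cases hi : i ∈ D
        · rw [Finset.piecewise_eq_of_mem _ _ _ hi, hbox]
          exact (Nat.pow_le_pow_right (by norm_num) (Nat.le_succ _)).trans (hpow2 n i)
        · rw [Finset.piecewise_eq_of_notMem _ _ _ hi, hbox]
  have hreach : ∀ n, AvgReach (fun k v => ℓ v ^ τ k) (box n)
      (∑ i ∈ Finset.range n, ∑ k, cost i k) := by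
    intro n
    induction n with
    | zero =>
      refine ⟨fun _ => 0, fun v hv => ?_, by simp⟩
      have : v = 0 := by
        ext k
        have := Fintype.mem_piFinset.1 hv k
        simp only [box, Finset.mem_Ico] at this
        simp at this
        simpa using this
      rw [this]
      exact CostReach.zero
    | succ n ih =>
      rw [Finset.sum_range_succ]
      simpa using hstep n _ ih Finset.univ
  have hsum : Summable fun n => ∑ k, cost n k := by
    refine summable_sum fun k _ => ?_
    have hgeo : ∀ n, cost n k = (1 + M) * 2 ^ (s k + 1) *
        ((2 : ℝ) ^ ((s k : ℝ) - τ k * ∑ i, (s i : ℝ))) ^ n := by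
      intro n
      have h1 : L n = (2 : ℝ) ^ ((n : ℝ) * ∑ i, (s i : ℝ)) := by
        simp only [L]
        rw [Finset.prod_pow_eq_pow_sum, ← Real.rpow_natCast, Finset.mul_sum]
        push_cast
        rfl
      simp only [cost]
      rw [h1, ← Real.rpow_mul (by norm_num), ← Real.rpow_mul_natCast (by norm_num),
        mul_assoc (1 + M), mul_assoc (1 + M)]
      congr 1
      push_cast
      rw [← Real.rpow_natCast, ← Real.rpow_natCast, ← Real.rpow_add (by norm_num),
        ← Real.rpow_add (by norm_num)]
      congr 1
      push_cast
      ring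
    simp_rw [hgeo]
    refine (summable_geometric_of_lt_one (by positivity) ?_).mul_left _
    exact Real.rpow_lt_one_of_one_lt_of_neg (by norm_num) (by linarith [hs k])
  refine ⟨∑' n, ∑ k, cost n k, fun N => ?_⟩
  obtain ⟨m, hm, hmκ⟩ := hreach N
  set Y := 2 ^ ((N + 1) * s k₀ + 1)
  have hline := sum_line_le hℓ hM (hτ0 k₀) (hτ1 k₀) (hL N) (box N) k₀ (hne N k₀) Y (by
    rw [hbox]; exact Nat.pow_le_pow_right (by norm_num) (by have := hpow N k₀; omega))
    (hLcard N _ fun k => (hbox N k).ge)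
  obtain ⟨u, hu, humin⟩ := Finset.exists_le_of_sum_le (s := Fintype.piFinset (box N))
    (Fintype.piFinset_nonempty.2 (hne N))
    (f := fun u => m u + ∑ x ∈ Finset.range Y, ℓ (update u k₀ x) ^ τ k₀)
    (g := fun _ => ∑ i ∈ Finset.range N, ∑ k, cost i k + cost N k₀) (by
      rw [Finset.sum_add_distrib, Finset.sum_const, nsmul_eq_mul, mul_add]
      exact add_le_add hmκ hline)
  refine ⟨u, fun j hj => ?_⟩
  have hK : ∑ i ∈ Finset.range N, ∑ k, cost i k + cost N k₀ ≤ ∑' n, ∑ k, cost n k :=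
    calc _ ≤ ∑ i ∈ Finset.range (N + 1), ∑ k, cost i k := by
          rw [Finset.sum_range_succ]
          exact add_le_add le_rfl (Finset.single_le_sum (fun k _ => hcost0 N k)
            (Finset.mem_univ k₀))
      _ ≤ _ := hsum.sum_le_tsum _ fun n _ => Finset.sum_nonneg fun k _ => hcost0 n k
  refine CostReach.mono (humin.trans hK) ?_
  have huk := Fintype.mem_piFinset.1 hu k₀
  have hu' : CostReach (fun k v => ℓ v ^ τ k) (update (update u k₀ (u k₀ + j)) k₀ (u k₀)) (m u) := by
    simpa using hm u hu
  have := hu'.line_of_le (fun k v => Real.rpow_nonneg (hℓ v) _) (Y := Y) (by simp) (by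
    simp only [update_self]
    simp only [box, Finset.mem_Ico] at huk
    have h1 : N < 2 ^ (N * s k₀ + 1) :=
      (Nat.lt_two_pow_self).trans_le (Nat.pow_le_pow_right (by norm_num)
        ((Nat.le_mul_of_pos_right N (hs1 k₀)).trans (Nat.le_succ _)))
    have h2 : Y = 2 * 2 ^ ((N + 1) * s k₀) := pow_succ' _ _
    have := hpow2 N k₀
    omega)
  simpa using this

end Lattice

section Plateaus

open MeasureTheory

theorem exists_return_time {α : ℝ} (hα : Irrational α) {ε : ℝ} (hε : 0 < ε) :
    ∃ N : ℕ, ∀ y : ℝ, ∃ j ≤ N, ∃ m : ℤ, m < y + j * α ∧ y + j * α < m + ε := by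
  obtain ⟨n, hn⟩ := exists_nat_gt (1 / ε)
  have hn0 : 0 < n := by
    have : (0 : ℝ) < n := (by positivity : (0 : ℝ) < 1 / ε).trans hn
    exact_mod_cast this
  obtain ⟨k, hk0, -, hk⟩ := Real.exists_nat_abs_mul_sub_round_le α hn0
  set p := round (k * α)
  set β : ℝ := k * α - p with hβdef
  have hβε : |β| < ε := by
    refine hk.trans_lt ?_
    rw [div_lt_iff₀ (by positivity)]
    rw [div_lt_iff₀ hε] at hn
    nlinarith
  have hβ0 : β ≠ 0 := by
    rw [hβdef]
    exact ((hα.natCast_mul hk0.ne').sub_intCast p).ne_zero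
  have hβpos : 0 < |β| := abs_pos.2 hβ0
  obtain ⟨Q, hQ⟩ := exists_nat_gt (1 / |β| + 1)
  suffices H : ∀ y : ℝ, ∃ i ≤ Q, ∃ m : ℤ, m < y + i * β ∧ y + i * β < m + ε by
    refine ⟨Q * k, fun y => ?_⟩
    obtain ⟨i, hi, m, h1, h2⟩ := H y
    refine ⟨i * k, Nat.mul_le_mul_right _ hi, m + i * p, ?_, ?_⟩
    · push_cast; rw [hβdef] at h1; linarith
    · push_cast; rw [hβdef] at h2; linarith
  intro y
  rcases hβ0.lt_or_gt with hneg | hpos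
  · rw [abs_of_neg hneg] at hβε hQ hβpos
    have hd0 : 0 < y - ((⌈y⌉ - 1 : ℤ) : ℝ) := by
      push_cast; linarith [Int.ceil_lt_add_one y]
    have hd1 : y - ((⌈y⌉ - 1 : ℤ) : ℝ) ≤ 1 := by
      push_cast; linarith [Int.le_ceil y]
    set d := y - ((⌈y⌉ - 1 : ℤ) : ℝ) with hd
    have hc : 0 < ⌈d / -β⌉₊ := Nat.ceil_pos.2 (div_pos hd0 hβpos)
    obtain ⟨i, hi⟩ := Nat.exists_eq_succ_of_ne_zero hc.ne'
    have hup := Nat.le_ceil (d / -β)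
    have hlo := Nat.ceil_lt_add_one (div_pos hd0 hβpos).le
    rw [hi] at hup hlo
    push_cast at hup hlo
    rw [div_le_iff₀ hβpos] at hup
    have hlo' : (i : ℝ) < d / -β := by linarith
    have hiQ : (i : ℝ) < Q := by
      have : d / -β ≤ 1 / -β := by gcongr
      linarith
    rw [lt_div_iff₀ hβpos] at hlo'
    refine ⟨i, by exact_mod_cast hiQ.le, ⌈y⌉ - 1, ?_, ?_⟩ <;> linarith
  · rw [abs_of_pos hpos] at hβε hQ
    have hd0 : 0 < ((⌊y⌋ + 1 : ℤ) : ℝ) - y := by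
      push_cast; linarith [Int.lt_floor_add_one y]
    have hd1 : ((⌊y⌋ + 1 : ℤ) : ℝ) - y ≤ 1 := by
      push_cast; linarith [Int.floor_le y]
    set d := ((⌊y⌋ + 1 : ℤ) : ℝ) - y with hd
    have hlo := Nat.floor_le (div_pos hd0 hpos).le
    have hup := Nat.lt_floor_add_one (d / β)
    rw [le_div_iff₀ hpos] at hlo
    have hiQ : ((⌊d / β⌋₊ + 1 : ℕ) : ℝ) < Q := by
      have h1 : d / β ≤ 1 / β := by gcongr
      have h2 := Nat.floor_le (div_pos hd0 hpos).le
      push_cast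
      linarith
    rw [div_lt_iff₀ hpos] at hup
    refine ⟨⌊d / β⌋₊ + 1, by exact_mod_cast hiQ.le, ⌊y⌋ + 1, ?_, ?_⟩
    · push_cast at *; linarith
    · push_cast at *; linarith

theorem CircleDeg1Lift.sum_volume_fiber_le {β : Type*} (h : CircleDeg1Lift) (Y : β → ℝ)
    (hY : Function.Injective fun i => Int.fract (Y i)) (s : Finset β) :
    ∑ i ∈ s, volume.real (h ⁻¹' {Y i}) ≤ 4 := by
  have hmeas : Measurable h := h.monotone.measurable
  have hfract : ∀ y, volume.real (h ⁻¹' {y}) = volume.real (h ⁻¹' {Int.fract y}) := by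
    intro y
    have : h ⁻¹' {y} = (· + (-(⌊y⌋ : ℝ))) ⁻¹' (h ⁻¹' {Int.fract y}) := by
      ext x
      simp only [mem_preimage, mem_singleton_iff, ← sub_eq_add_neg, Int.fract]
      rw [h.map_sub_int, sub_left_inj]
    rw [this, measureReal_def, measure_preimage_add_right, measureReal_def]
  have hsub : ⋃ i ∈ s, h ⁻¹' {Int.fract (Y i)} ⊆ Icc (-h 0 - 1) (-h 0 + 3) := by
    intro x hx
    simp only [mem_iUnion, mem_preimage, mem_singleton_iff] at hx
    obtain ⟨i, -, hx⟩ := hx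
    have h0 := Int.fract_nonneg (Y i)
    have h1 := Int.fract_lt_one (Y i)
    have h2 := h.map_le_of_map_zero x
    have h3 := h.le_map_of_map_zero x
    have h4 := Int.ceil_lt_add_one x
    have h5 := Int.lt_floor_add_one x
    constructor <;> linarith
  rw [Finset.sum_congr rfl fun i _ => hfract (Y i)]
  rw [← measureReal_biUnion_finset (s := s) (f := fun i => h ⁻¹' {Int.fract (Y i)})
    (h := fun i hi => measure_ne_top_of_subset ((subset_biUnion_of_mem
      (u := fun i => h ⁻¹' {Int.fract (Y i)}) hi).trans hsub) (by simp))]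
  · refine (measureReal_mono hsub (by simp)).trans ?_
    rw [Real.volume_real_Icc_of_le (by linarith)]
    linarith
  · intro i _ j _ hij
    refine Disjoint.preimage _ (disjoint_singleton.2 fun he => hij (hY he))
  · exact fun i _ => hmeas (measurableSet_singleton _)

theorem CircleDeg1Lift.exists_fiber_eq_Icc (h : CircleDeg1Lift) (hc : Continuous h)
    {x y : ℝ} (hxy : x < y) (he : h x = h y) :
    ∃ a b, a < b ∧ h ⁻¹' {h a} = Icc a b := by
  have hconn : IsConnected (h ⁻¹' {h x}) := by
    refine ⟨⟨x, rfl⟩, ?_⟩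
    rw [isPreconnected_iff_ordConnected]
    exact ordConnected_singleton.preimage_mono h.monotone
  have hcomp : IsCompact (h ⁻¹' {h x}) := by
    refine isCompact_Icc.of_isClosed_subset (isClosed_singleton.preimage hc)
      (s := Icc (x - 1) (x + 1)) ?_
    intro z hz
    have hz' : h z = h x := hz
    constructor
    · by_contra! hlt
      have := h.monotone hlt.le
      have h2 := h.map_sub_int x 1
      push_cast at h2
      linarith
    · by_contra! hlt
      have := h.monotone hlt.le
      have h2 := h.map_add_one x
      linarith
  have hI := eq_Icc_of_connected_compact hconn hcomp
  have hx : x ∈ Icc (sInf (h ⁻¹' {h x})) (sSup (h ⁻¹' {h x})) := hI ▸ rfl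
  have hy : y ∈ Icc (sInf (h ⁻¹' {h x})) (sSup (h ⁻¹' {h x})) := hI ▸ he.symm
  have ha : sInf (h ⁻¹' {h x}) ∈ h ⁻¹' {h x} :=
    hI.symm.subset (left_mem_Icc.2 (hx.1.trans hx.2))
  refine ⟨sInf (h ⁻¹' {h x}), sSup (h ⁻¹' {h x}), (hx.1.trans_lt hxy).trans_le hy.2, ?_⟩
  rw [show h (sInf (h ⁻¹' {h x})) = h x from ha]
  exact hI

theorem IsCircleDiffeoLift.differentiable {f : ℝ → ℝ} (hf : IsCircleDiffeoLift f) :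
    Differentiable ℝ f :=
  hf.2.2.1.differentiable (by norm_num)

theorem IsCircleDiffeoLift.surjective {f : ℝ → ℝ} (hf : IsCircleDiffeoLift f) :
    Function.Surjective f := by
  let F : CircleDeg1Lift := ⟨⟨f, hf.1.monotone⟩, hf.2.1⟩
  exact (F.continuous_iff_surjective).1 hf.differentiable.continuous

/-- One step of distortion control for the ratio of two adjacent intervals. -/
theorem IsCircleDiffeoLift.ratio_le {f : ℝ → ℝ} (hf : IsCircleDiffeoLift f) {C τ : ℝ}
    (hC : 0 ≤ C) (hτ0 : 0 < τ)
    (hD : ∀ x y, |x - y| ≤ 1 → deriv f x ≤ deriv f y * Real.exp (C * |x - y| ^ τ))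
    {p q r ρ : ℝ} (hpq : p < q) (hqr : q < r) (hpr : r ≤ p + 1)
    (hρ : r - q ≤ ρ * (q - p)) :
    f r - f q ≤ ρ * Real.exp (C * (r - p) ^ τ) * (f q - f p) := by
  have hρ0 : 0 < ρ := by
    by_contra! hneg
    nlinarith
  obtain ⟨ξ, hξ, hξ'⟩ := exists_deriv_eq_slope f hqr hf.differentiable.continuous.continuousOn
    hf.differentiable.differentiableOn
  obtain ⟨η, hη, hη'⟩ := exists_deriv_eq_slope f hpq hf.differentiable.continuous.continuousOn
    hf.differentiable.differentiableOn
  rw [eq_div_iff (by linarith)] at hξ' hη'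
  rw [← hξ', ← hη']
  have habs : |ξ - η| ≤ r - p := by
    rw [abs_le]; constructor <;> linarith [hξ.1, hξ.2, hη.1, hη.2]
  have h1 := hD ξ η (by linarith)
  have h2 : Real.exp (C * |ξ - η| ^ τ) ≤ Real.exp (C * (r - p) ^ τ) := by gcongr
  have hη0 := hf.2.2.2 η
  calc deriv f ξ * (r - q) ≤ (deriv f η * Real.exp (C * (r - p) ^ τ)) * (ρ * (q - p)) := by
        apply mul_le_mul (h1.trans (mul_le_mul_of_nonneg_left h2 hη0.le)) hρ (by linarith)
        positivity
    _ = _ := by ring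

variable {ι : Type*} [Fintype ι] [DecidableEq ι]

theorem sum_update_add_mul (α : ι → ℝ) (v : ι → ℕ) (k : ι) (n : ℕ) :
    ∑ i, (Function.update v k (v k + n) i : ℝ) * α i = ∑ i, v i * α i + n * α k := by
  have : ∀ i, (Function.update v k (v k + n) i : ℝ) * α i =
      v i * α i + if i = k then n * α k else 0 := by
    intro i
    rcases eq_or_ne i k with rfl | hi
    · simp; ring
    · simp [hi]
  simp_rw [this, Finset.sum_add_distrib]
  simp

/-- Along a path of cost `t` issued from the plateau `[a, b]`, the size of the image of the
neighbouring interval `[b, e]` relative to that of `[a, b]` grows at most by `exp (2 C t)`. -/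
theorem CostReach.exists_map {h : ℝ → ℝ} {f : ι → ℝ → ℝ} (hf : ∀ k, IsCircleDiffeoLift (f k))
    {α : ι → ℝ} (hsc : ∀ k x, h (f k x) = h x + α k) {τ : ι → ℝ} (hτ0 : ∀ k, 0 < τ k)
    (hτ1 : ∀ k, τ k ≤ 1) {C : ℝ} (hC : 0 ≤ C)
    (hD : ∀ k x y, |x - y| ≤ 1 →
      deriv (f k) x ≤ deriv (f k) y * Real.exp (C * |x - y| ^ τ k))
    {a b e ρ : ℝ} (hab : a < b) (hbe : b < e) (hea : e ≤ a + 1) (hfib : h ⁻¹' {h a} = Icc a b)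
    (hρ : e - b ≤ ρ * (b - a)) {v : ι → ℕ} {t : ℝ}
    (hv : CostReach (fun k v => volume.real (h ⁻¹' {h a + ∑ i, v i * α i}) ^ τ k) v t) :
    ρ * Real.exp (2 * C * t) ≤ 1 →
    ∃ g : ℝ → ℝ, Continuous g ∧ StrictMono g ∧ (∀ x, g (x + 1) = g x + 1) ∧
      (∀ x, h (g x) = h x + ∑ i, v i * α i) ∧
      h ⁻¹' {h a + ∑ i, v i * α i} = Icc (g a) (g b) ∧
      g e - g b ≤ ρ * Real.exp (2 * C * t) * (g b - g a) := by
  have hρ0 : 0 < ρ := by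
    by_contra! hneg
    nlinarith
  induction hv with
  | zero =>
    intro _
    exact ⟨id, continuous_id, strictMono_id, fun _ => rfl, by simp, by simpa using hfib,
      by simpa using hρ⟩
  | @mono v t t' htt _ ih =>
    intro ht'
    have hle : ρ * Real.exp (2 * C * t) ≤ ρ * Real.exp (2 * C * t') := by gcongr
    obtain ⟨g, h1, h2, h3, h4, h5, h6⟩ := ih (hle.trans ht')
    refine ⟨g, h1, h2, h3, h4, h5, h6.trans ?_⟩
    exact mul_le_mul_of_nonneg_right hle (sub_nonneg.2 (h2 hab).le)
  | @step v t k _ ih =>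
    intro ht'
    set ℓ := volume.real (h ⁻¹' {h a + ∑ i, v i * α i}) with hℓ
    have hℓ0 : 0 ≤ ℓ ^ τ k := Real.rpow_nonneg measureReal_nonneg _
    have hle : ρ * Real.exp (2 * C * t) ≤ ρ * Real.exp (2 * C * (t + ℓ ^ τ k)) := by
      gcongr; linarith
    obtain ⟨g, h1, h2, h3, h4, h5, h6⟩ := ih (hle.trans ht')
    have hsum : ∑ i, (Function.update v k (v k + 1) i : ℝ) * α i = ∑ i, v i * α i + α k := by
      simpa using sum_update_add_mul α v k 1
    have hgab := h2 hab
    refine ⟨f k ∘ g, (hf k).differentiable.continuous.comp h1, (hf k).1.comp h2, ?_, ?_, ?_, ?_⟩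
    · intro x; simp [h3, (hf k).2.1]
    · intro x
      rw [hsum, Function.comp, hsc, h4]; ring
    · rw [hsum]
      ext z
      obtain ⟨x, rfl⟩ := (hf k).surjective z
      have : x ∈ h ⁻¹' {h a + ∑ i, v i * α i} ↔ x ∈ Icc (g a) (g b) := by rw [h5]
      simp only [mem_preimage, mem_singleton_iff, hsc, ← add_assoc, add_left_inj, Function.comp,
        mem_Icc, (hf k).1.le_iff_le] at this ⊢
      exact this
    · have hℓg : ℓ = g b - g a := by
        rw [hℓ, h5, Real.volume_real_Icc_of_le hgab.le]
      have hr := (hf k).ratio_le hC (hτ0 k) (hD k) hgab (h2 hbe)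
        (by rw [← h3]; exact h2.monotone hea) h6
      refine hr.trans (mul_le_mul_of_nonneg_right ?_ (sub_nonneg.2 ((hf k).1 hgab).le))
      have hJ : g e - g a ≤ 2 * ℓ := by
        have : g e - g b ≤ 1 * (g b - g a) :=
          h6.trans (mul_le_mul_of_nonneg_right (hle.trans ht') (sub_nonneg.2 hgab.le))
        linarith
      have hJ' : (g e - g a) ^ τ k ≤ 2 * ℓ ^ τ k := by
        refine (Real.rpow_le_rpow (by linarith [h2 hbe]) hJ (hτ0 k).le).trans ?_
        rw [Real.mul_rpow (by norm_num) measureReal_nonneg]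
        refine mul_le_mul_of_nonneg_right ?_ hℓ0
        exact (Real.rpow_le_rpow_of_exponent_le (by norm_num) (hτ1 k)).trans_eq
          (Real.rpow_one 2)
      rw [mul_assoc, ← Real.exp_add]
      gcongr
      nlinarith

/-- Under `∑ τ k > 1`, a semiconjugacy to rationally independent rotations has no plateau. -/
theorem injective_of_semiconj_rotations (h : CircleDeg1Lift) (hc : Continuous h)
    {f : ι → ℝ → ℝ} (hf : ∀ k, IsCircleDiffeoLift (f k))
    {α : ι → ℝ} (hsc : ∀ k x, h (f k x) = h x + α k) {τ : ι → ℝ} (hτ0 : ∀ k, 0 < τ k)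
    (hτ1 : ∀ k, τ k ≤ 1) (hτ : 1 < ∑ k, τ k) {C : ℝ} (hC : 0 ≤ C)
    (hD : ∀ k x y, |x - y| ≤ 1 →
      deriv (f k) x ≤ deriv (f k) y * Real.exp (C * |x - y| ^ τ k))
    (hirr : ∀ k, Irrational (α k))
    (hfree : ∀ (v w : ι → ℕ) (m : ℤ), ∑ i, v i * α i = ∑ i, w i * α i + m → v = w) :
    Function.Injective h := by
  by_contra hninj
  simp only [Function.Injective, not_forall] at hninj
  obtain ⟨x, y, hxy, hne⟩ := hninj
  obtain ⟨a, b, hab, hfib⟩ : ∃ a b, a < b ∧ h ⁻¹' {h a} = Icc a b := by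
    rcases lt_or_gt_of_ne hne with hlt | hlt
    · exact h.exists_fiber_eq_Icc hc hlt hxy
    · exact h.exists_fiber_eq_Icc hc hlt hxy.symm
  have hhb : h b = h a := by
    have : b ∈ h ⁻¹' {h a} := hfib ▸ right_mem_Icc.2 hab.le
    exact this
  have hgt : ∀ z, b < z → h a < h z := by
    intro z hz
    refine lt_of_le_of_ne (hhb ▸ h.monotone hz.le) fun he => ?_
    have : z ∈ Icc a b := hfib ▸ he.symm
    exact absurd this.2 (not_le.2 hz)
  have hb1 : b < a + 1 := by
    by_contra! hge
    have := h.monotone hge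
    rw [h.map_add_one, hhb] at this
    linarith
  obtain ⟨k₀⟩ : Nonempty ι := by
    by_contra hemp
    rw [not_nonempty_iff] at hemp
    simp at hτ
    linarith
  obtain ⟨K, hK⟩ := exists_long_segment (ℓ := fun v => volume.real (h ⁻¹' {h a + ∑ i, v i * α i}))
    (fun v => measureReal_nonneg) (h.sum_volume_fiber_le _ (by
      intro v w hvw
      obtain ⟨m, hm⟩ := Int.fract_eq_fract.1 hvw
      exact hfree v w m (by linarith))) hτ0 hτ1 hτ k₀
  set ρ := Real.exp (-(2 * C * K)) with hρ
  have hρ1 : ρ * Real.exp (2 * C * K) ≤ 1 := by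
    rw [hρ, ← Real.exp_add]; simp
  set δ := min (ρ * (b - a)) (a + 1 - b) with hδ
  have hδ0 : 0 < δ := lt_min (mul_pos (Real.exp_pos _) (sub_pos.2 hab)) (sub_pos.2 hb1)
  have hε : 0 < h (b + δ / 2) - h a := sub_pos.2 (hgt _ (by linarith))
  obtain ⟨N, hN⟩ := exists_return_time (hirr k₀) hε
  obtain ⟨u, hu⟩ := hK N
  obtain ⟨j, hj, m, hm1, hm2⟩ := hN (∑ i, u i * α i)
  obtain ⟨g, hg1, hg2, -, hg4, -, hg6⟩ := (hu j hj).exists_map hf hsc hτ0 hτ1 hC hD hab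
    (show b < b + δ by linarith) (by linarith [min_le_right (ρ * (b - a)) (a + 1 - b)]) hfib
    (ρ := ρ) (by linarith [min_le_left (ρ * (b - a)) (a + 1 - b)]) hρ1
  rw [sum_update_add_mul] at hg4
  have hga : b < g a - m := by
    by_contra! hle
    have := h.monotone hle
    rw [h.map_sub_int, hg4, hhb] at this
    linarith
  have hgb : g b - m < b + δ / 2 := by
    by_contra! hle
    have := h.monotone hle
    rw [h.map_sub_int, hg4, hhb] at this
    linarith
  have hge : g (b + δ) - m < b + δ := by
    have hgab := hg2 hab
    have : g (b + δ) - g b ≤ 1 * (g b - g a) :=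
      hg6.trans (mul_le_mul_of_nonneg_right hρ1 (sub_nonneg.2 hgab.le))
    linarith
  obtain ⟨z, -, hz⟩ := intermediate_value_Icc' (show a ≤ b + δ by linarith)
    (f := fun z => g z - m - z) (by fun_prop) (show (0 : ℝ) ∈ _ from ⟨by linarith, by linarith⟩)
  have hz' : g z - m = z := by simpa [sub_eq_zero] using hz
  have h1 := hg4 z
  rw [sub_eq_iff_eq_add.1 hz', h.map_add_int] at h1
  linarith

end Plateaus

section Exponents

theorem IsConcaveModulus.mul_le {w : ℝ → ℝ} (hw : IsConcaveModulus w) {x : ℝ}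
    (hx : x ∈ Icc (0 : ℝ) 1) : x * w 1 ≤ w x := by
  have h := hw.2.2 (show (0 : ℝ) ∈ Icc (0 : ℝ) 1 by simp) (show (1 : ℝ) ∈ Icc (0 : ℝ) 1 by simp)
    (sub_nonneg.2 hx.2) hx.1 (by ring)
  simpa [hw.1.2.2.1] using h

theorem IsModulus.pos {w : ℝ → ℝ} (hw : IsModulus w) {x : ℝ} (hx : 0 < x) (hx1 : x ≤ 1) :
    0 < w x := by
  have := hw.2.1 (show (0 : ℝ) ∈ Icc (0 : ℝ) 1 by simp) ⟨hx.le, hx1⟩ hx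
  rwa [hw.2.2.1] at this

/-- A submultiplicative function tending to `0` at `0` is not bounded below by `c x ^ θ` for
small `θ`. -/
theorem exists_exponent_of_submultiplicative {ω : ℝ → ℝ} (hω : ∀ t ∈ Ioc (0 : ℝ) 1, 0 ≤ ω t)
    (hlim : Tendsto ω (nhdsWithin 0 (Ioi 0)) (nhds 0)) {C : ℝ} (hC : 0 < C)
    (hsub : ∀ t₁ ∈ Icc (0 : ℝ) 1, ∀ t₂ ∈ Icc (0 : ℝ) 1, ω (t₁ * t₂) ≤ C * ω t₁ * ω t₂) :
    ∃ θ > (0 : ℝ), ∀ c > (0 : ℝ), ∀ δ > (0 : ℝ), ∃ x ∈ Ioo (0 : ℝ) δ, x < 1 ∧ ω x < c * x ^ θ := by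
  have h1 : ∀ᶠ t in nhdsWithin (0 : ℝ) (Ioi 0), ω t < 1 / (2 * C) :=
    hlim.eventually_lt_const (by positivity)
  obtain ⟨t, ht, ht0, ht1⟩ := (h1.and (Ioo_mem_nhdsGT (zero_lt_one' ℝ))).exists
  have htC : C * ω t ≤ 1 / 2 := by
    rw [lt_div_iff₀ (by positivity)] at ht
    linarith
  have hmem : ∀ n : ℕ, t ^ n ∈ Ioc (0 : ℝ) 1 := fun n =>
    ⟨pow_pos ht0 n, pow_le_one₀ ht0.le ht1.le⟩
  have hpow : ∀ n : ℕ, C * ω (t ^ (n + 1)) ≤ (1 / 2) ^ (n + 1) := by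
    intro n
    induction n with
    | zero => simpa using htC
    | succ n ih =>
      have h2 := hsub _ (Ioc_subset_Icc_self (hmem (n + 1))) t ⟨ht0.le, ht1.le⟩
      rw [← pow_succ] at h2
      have h3 := mul_le_mul ih htC (mul_nonneg hC.le (hω t ⟨ht0, ht1.le⟩)) (by positivity)
      rw [pow_succ (1 / 2 : ℝ) (n + 1)]
      nlinarith
  refine ⟨Real.logb t (3 / 4), Real.logb_pos_of_base_lt_one ht0 ht1 (by norm_num) (by norm_num),
    fun c hc δ hδ => ?_⟩
  have hA : ∀ᶠ n : ℕ in atTop, t ^ (n + 1) < δ :=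
    ((tendsto_pow_atTop_nhds_zero_of_lt_one ht0.le ht1).comp
      (tendsto_add_atTop_nat 1)).eventually_lt_const hδ
  have hB : ∀ᶠ n : ℕ in atTop, (2 / 3 : ℝ) ^ (n + 1) < c * C :=
    ((tendsto_pow_atTop_nhds_zero_of_lt_one (by norm_num : (0 : ℝ) ≤ 2 / 3) (by norm_num)).comp
      (tendsto_add_atTop_nat 1)).eventually_lt_const (mul_pos hc hC)
  obtain ⟨n, hn1, hn2⟩ := (hA.and hB).exists
  refine ⟨t ^ (n + 1), ⟨(hmem _).1, hn1⟩, pow_lt_one₀ ht0.le ht1 (by simp), ?_⟩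
  have h3 : (t ^ (n + 1)) ^ Real.logb t (3 / 4) = (3 / 4 : ℝ) ^ (n + 1) := by
    rw [← Real.rpow_natCast, ← Real.rpow_mul ht0.le, mul_comm, Real.rpow_mul ht0.le,
      Real.rpow_logb ht0 ht1.ne (by norm_num), Real.rpow_natCast]
  rw [h3]
  refine lt_of_mul_lt_mul_left ?_ hC.le
  calc C * ω (t ^ (n + 1)) ≤ (1 / 2) ^ (n + 1) := hpow n
    _ = (2 / 3) ^ (n + 1) * (3 / 4) ^ (n + 1) := by rw [← mul_pow]; norm_num
    _ < c * C * (3 / 4) ^ (n + 1) := by gcongr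
    _ = _ := by ring

theorem exists_holder_exponents {d : ℕ} {ωs : Fin d → ℝ → ℝ} {ω : ℝ → ℝ}
    (hmod : ∀ k, IsConcaveModulus (ωs k))
    (hprod : ∀ t ∈ Icc (0 : ℝ) 1, (∏ k, ωs k t) = t * ω t)
    (hlim : Tendsto ω (nhdsWithin 0 (Ioi 0)) (nhds 0)) {C : ℝ} (hC : 0 < C)
    (hsub : ∀ t₁ ∈ Icc (0 : ℝ) 1, ∀ t₂ ∈ Icc (0 : ℝ) 1, ω (t₁ * t₂) ≤ C * ω t₁ * ω t₂)
    (hcomp : ComparableWithHolder ωs) :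
    ∃ (P : Finset (Fin d)) (a : Fin d → ℝ), 1 < ∑ k ∈ P, a k ∧ ∀ k ∈ P, a k ∈ Ioo (0 : ℝ) 1 ∧
      ∃ δ > (0 : ℝ), ∀ x ∈ Ioo (0 : ℝ) δ, ωs k x ≤ x ^ a k := by
  obtain ⟨δ, hδ, -, hcomp⟩ := hcomp
  have hω : ∀ t ∈ Ioc (0 : ℝ) 1, 0 ≤ ω t := by
    intro t ht
    have h1 := hprod t ⟨ht.1.le, ht.2⟩
    have h2 : 0 ≤ ∏ k, ωs k t :=
      Finset.prod_nonneg fun k _ => ((hmod k).1.pos ht.1 ht.2).le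
    rw [h1] at h2
    exact nonneg_of_mul_nonneg_right h2 ht.1
  let S : Fin d → Set ℝ := fun k => {a | a ∈ Ioo (0 : ℝ) 1 ∧ ∀ x ∈ Ioo (0 : ℝ) δ, ωs k x ≤ x ^ a}
  let τ : Fin d → ℝ := fun k => sSup (insert 0 (S k))
  have hbdd : ∀ k, BddAbove (insert 0 (S k)) := by
    refine fun k => ⟨1, ?_⟩
    rintro a (rfl | ha)
    · exact zero_le_one
    · exact ha.1.2.le
  have hτ0 : ∀ k, 0 ≤ τ k := fun k => le_csSup (hbdd k) (mem_insert _ _)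
  have hlow : ∀ k, ∀ η > (0 : ℝ), ∀ x ∈ Ioo (0 : ℝ) δ, x < 1 →
      min 1 (ωs k 1) * x ^ (τ k + η) ≤ ωs k x := by
    intro k η hη x hx hx1
    have hp := Real.rpow_pos_of_pos hx.1 (τ k + η)
    rcases lt_or_ge (τ k + η) 1 with hlt | hge
    · have hmem : τ k + η ∈ Ioo (0 : ℝ) 1 := ⟨by linarith [hτ0 k], hlt⟩
      rcases hcomp k _ hmem with h | h
      · have : τ k + η ≤ τ k := le_csSup (hbdd k) (mem_insert_of_mem _ ⟨hmem, h⟩)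
        linarith
      · calc min 1 (ωs k 1) * x ^ (τ k + η) ≤ 1 * x ^ (τ k + η) := by
              gcongr; exact min_le_left _ _
          _ ≤ _ := by rw [one_mul]; exact h x hx
    · have h1 : x ^ (τ k + η) ≤ x := by
        simpa using Real.rpow_le_rpow_of_exponent_ge hx.1 hx1.le hge
      have h2 := (hmod k).1.pos one_pos le_rfl
      calc min 1 (ωs k 1) * x ^ (τ k + η) ≤ ωs k 1 * x := by
            gcongr; exact min_le_right _ _
        _ ≤ _ := by rw [mul_comm]; exact (hmod k).mul_le ⟨hx.1.le, hx1.le⟩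
  have hsum : 1 < ∑ k, τ k := by
    by_contra! hle
    obtain ⟨θ, hθ, H⟩ := exists_exponent_of_submultiplicative hω hlim hC hsub
    have hc : 0 < ∏ k, min 1 (ωs k 1) :=
      Finset.prod_pos fun k _ => lt_min one_pos ((hmod k).1.pos one_pos le_rfl)
    obtain ⟨x, hx, hx1, hxω⟩ := H _ hc δ hδ
    have hd : (0 : ℝ) < d + 1 := by positivity
    have h1 : ∏ k, (min 1 (ωs k 1) * x ^ (τ k + θ / (d + 1))) ≤ ∏ k, ωs k x :=
      Finset.prod_le_prod (fun k _ => mul_nonneg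
        (lt_min one_pos ((hmod k).1.pos one_pos le_rfl)).le (Real.rpow_nonneg hx.1.le _))
        fun k _ => hlow k _ (by positivity) x hx hx1
    rw [Finset.prod_mul_distrib, ← Real.rpow_sum_of_pos hx.1, hprod x ⟨hx.1.le, hx1.le⟩,
      Finset.sum_add_distrib] at h1
    have h2 : ∑ k, τ k + ∑ _k : Fin d, θ / (d + 1) ≤ 1 + θ := by
      refine add_le_add hle ?_
      simp only [Finset.sum_const, Finset.card_univ, Fintype.card_fin, nsmul_eq_mul]
      rw [mul_div_assoc', div_le_iff₀ hd]
      nlinarith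
    have h3 := Real.rpow_le_rpow_of_exponent_ge hx.1 hx1.le h2
    rw [Real.rpow_add hx.1, Real.rpow_one] at h3
    have h4 := mul_le_mul_of_nonneg_left h3 hc.le
    have h5 := mul_lt_mul_of_pos_left hxω hx.1
    linarith
  let ε := (∑ k, τ k - 1) / (d + 1)
  have hε : 0 < ε := div_pos (by linarith) (by positivity)
  have hex : ∀ k, ∃ a, 0 < τ k → a ∈ S k ∧ τ k - ε < a := by
    intro k
    by_cases hk : 0 < τ k
    · obtain ⟨a, ha, hlt⟩ := exists_lt_of_lt_csSup (insert_nonempty 0 (S k))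
        (show max 0 (τ k - ε) < sSup (insert 0 (S k)) from max_lt hk (by linarith))
      rcases ha with rfl | ha
      · exact absurd (le_max_left 0 (τ k - ε)) (not_le.2 hlt)
      · exact ⟨a, fun _ => ⟨ha, (le_max_right _ _).trans_lt hlt⟩⟩
    · exact ⟨0, fun h => absurd h hk⟩
  choose a ha using hex
  refine ⟨Finset.univ.filter fun k => 0 < τ k, a, ?_, fun k hk => ?_⟩
  · have h1 : ∑ k, (τ k - ε) ≤ ∑ k with 0 < τ k, a k := by
      rw [Finset.sum_filter]
      refine Finset.sum_le_sum fun k _ => ?_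
      split_ifs with hk
      · exact (ha k hk).2.le
      · linarith
    have h2 : (d + 1) * ε = ∑ k, τ k - 1 := mul_div_cancel₀ _ (by positivity)
    rw [Finset.sum_sub_distrib] at h1
    simp only [Finset.sum_const, Finset.card_univ, Fintype.card_fin, nsmul_eq_mul] at h1
    linarith
  · obtain ⟨h1, -⟩ := ha k (Finset.mem_filter.1 hk).2
    exact ⟨h1.1, δ, hδ, h1.2⟩

theorem IsCircleDiffeoLift.exists_deriv_le_mul_exp {f w : ℝ → ℝ} (hf : IsCircleDiffeoLift f)
    (hw : IsModulus w) (hreg : OmegaCont w (deriv f)) {a δ : ℝ} (ha : 0 < a) (hδ : 0 < δ)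
    (hwa : ∀ x ∈ Ioo (0 : ℝ) δ, w x ≤ x ^ a) :
    ∃ C, 0 ≤ C ∧
      ∀ x y, |x - y| ≤ 1 → deriv f x ≤ deriv f y * Real.exp (C * |x - y| ^ a) := by
  obtain ⟨K, hK⟩ := hreg
  have hcont : Continuous (deriv f) := hf.2.2.1.continuous_deriv le_rfl
  have hper : Function.Periodic (deriv f) 1 := by
    intro x
    rw [← deriv_comp_add_const, show (fun x => f (x + 1)) = fun x => f x + 1 from funext hf.2.1]
    simp
  obtain ⟨m, hm0, hm⟩ : ∃ m > 0, ∀ x, m ≤ deriv f x := by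
    obtain ⟨z, -, hz⟩ := isCompact_Icc.exists_isMinOn (nonempty_Icc.2 zero_le_one)
      (hcont.continuousOn (s := Icc (0 : ℝ) 1))
    refine ⟨deriv f z, hf.2.2.2 z, fun x => ?_⟩
    obtain ⟨y, hy, hxy⟩ := hper.exists_mem_Ico₀ one_pos x
    rw [hxy]
    exact hz (Ico_subset_Icc_self hy)
  have hw1 := hw.pos one_pos le_rfl
  have hA : ∀ t ∈ Icc (0 : ℝ) 1, w t ≤ (1 + w 1 / δ ^ a) * t ^ a := by
    intro t ht
    have hta := Real.rpow_nonneg ht.1 a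
    have hδa := Real.rpow_pos_of_pos hδ a
    rcases ht.1.eq_or_lt with rfl | ht0
    · rw [hw.2.2.1, Real.zero_rpow ha.ne', mul_zero]
    rcases lt_or_ge t δ with hlt | hge
    · have := hwa t ⟨ht0, hlt⟩
      have : 0 ≤ w 1 / δ ^ a * t ^ a := by positivity
      linarith
    · have h1 : w t ≤ w 1 := hw.2.1.monotoneOn ht (by simp) ht.2
      have h2 : w 1 ≤ w 1 / δ ^ a * t ^ a := by
        rw [div_mul_eq_mul_div, le_div_iff₀ hδa]
        gcongr
      linarith
  refine ⟨|K| * (1 + w 1 / δ ^ a) / m, by positivity, fun x y hxy => ?_⟩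
  have hD := hK x y hxy
  have h1 := hA _ ⟨abs_nonneg (x - y), hxy⟩
  have hwnn := hw.2.2.2 _ ⟨abs_nonneg (x - y), hxy⟩
  set E := |K| * (1 + w 1 / δ ^ a) / m * |x - y| ^ a with hE
  have hE0 : 0 ≤ E := by positivity
  have h2 : K * w |x - y| ≤ m * E := by
    calc K * w |x - y| ≤ |K| * ((1 + w 1 / δ ^ a) * |x - y| ^ a) :=
          mul_le_mul (le_abs_self K) h1 hwnn (abs_nonneg K)
      _ = m * E := by rw [hE]; field_simp
  have h3 := mul_le_mul_of_nonneg_right (hm y) hE0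
  have h4 := mul_le_mul_of_nonneg_left (Real.add_one_le_exp E) (hf.2.2.2 y).le
  linarith [le_abs_self (deriv f x - deriv f y)]

end Exponents

section Semiconjugacy

theorem exists_semiconj_rotations {κ : Type*} {f : κ → ℝ → ℝ}
    (hf : ∀ k, IsCircleDiffeoLift (f k)) (hcomm : ∀ i j, ∀ x, f i (f j x) = f j (f i x))
    {α : κ → ℝ} (hα : ∀ k, HasRotationNumber (f k) (α k)) {k₀ : κ} (hirr : Irrational (α k₀)) :
    ∃ h : CircleDeg1Lift, Continuous h ∧ ∀ k x, h (f k x) = h x + α k := by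
  let F : κ → CircleDeg1Lift := fun k => ⟨⟨f k, (hf k).1.monotone⟩, (hf k).2.1⟩
  have hF : ∀ k, CircleDeg1Lift.translationNumber (F k) = α k := fun k =>
    (F k).translationNumber_eq_of_tendsto₀ (hα k)
  obtain ⟨h, hh⟩ := CircleDeg1Lift.semiconj_of_bijective_of_translationNumber_eq (f₁ := F k₀)
    (f₂ := CircleDeg1Lift.translate (Multiplicative.ofAdd (α k₀)))
    ⟨(hf k₀).1.injective, (hf k₀).surjective⟩
    (CircleDeg1Lift.isUnit_iff_bijective.1 (Units.isUnit _))
    (by rw [hF, CircleDeg1Lift.translationNumber_translate])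
  have hh₀ : ∀ x, h (f k₀ x) = h x + α k₀ := fun x => by
    have := hh x
    rw [CircleDeg1Lift.translate_apply] at this
    rw [add_comm]
    exact this
  have hiter : ∀ (j : ℕ) x, h ((f k₀)^[j] x) = h x + j * α k₀ := by
    intro j x
    induction j with
    | zero => simp
    | succ j ih =>
      rw [Function.iterate_succ_apply', hh₀, ih]
      push_cast
      ring
  have hpoint : ∀ y z : ℝ, y < z → ∃ (j : ℕ) (m : ℤ),
      y < h ((f k₀)^[j] 0 - m) ∧ h ((f k₀)^[j] 0 - m) < z := by
    intro y z hyz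
    obtain ⟨N, hN⟩ := exists_return_time hirr (sub_pos.2 hyz)
    obtain ⟨j, -, m, h1, h2⟩ := hN (h 0 - y)
    refine ⟨j, m, ?_⟩
    rw [h.map_sub_int, hiter]
    constructor <;> linarith
  refine ⟨h, h.monotone.continuous_of_denseRange ?_, fun k => ?_⟩
  · refine dense_of_exists_between fun {y z} hyz => ?_
    obtain ⟨j, m, h1, h2⟩ := hpoint y z hyz
    exact ⟨_, mem_range_self _, h1, h2⟩
  · set c := h (f k 0) - h 0 with hc
    have hcj : ∀ (j : ℕ) (m : ℤ),
        h (f k ((f k₀)^[j] 0 - m)) = h ((f k₀)^[j] 0 - m) + c := by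
      intro j m
      have h1 : f k ((f k₀)^[j] 0 - m) = (f k₀)^[j] (f k 0) - m := by
        rw [show f k ((f k₀)^[j] 0 - m) = f k ((f k₀)^[j] 0) - m from (F k).map_sub_int _ m]
        rw [(Function.Commute.iterate_right (hcomm k k₀) j) 0]
      rw [h1, h.map_sub_int, h.map_sub_int, hiter, hiter, hc]
      ring
    have hkc : ∀ x, h (f k x) = h x + c := by
      intro x
      rcases lt_trichotomy (h (f k x)) (h x + c) with hlt | heq | hgt
      · obtain ⟨j, m, h1, h2⟩ := hpoint (h (f k x) - c) (h x) (by linarith)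
        have h3 : h (f k x) < h (f k ((f k₀)^[j] 0 - m)) := by rw [hcj]; linarith
        have h4 := (hf k).1.lt_iff_lt.1 (h.monotone.reflect_lt h3)
        exact absurd (h.monotone.reflect_lt h2) h4.not_gt
      · exact heq
      · obtain ⟨j, m, h1, h2⟩ := hpoint (h x) (h (f k x) - c) (by linarith)
        have h3 : h (f k ((f k₀)^[j] 0 - m)) < h (f k x) := by rw [hcj]; linarith
        have h4 := (hf k).1.lt_iff_lt.1 (h.monotone.reflect_lt h3)
        exact absurd (h.monotone.reflect_lt h1) h4.not_gt
    have hcα : α k = c := by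
      rw [← hF k, ← CircleDeg1Lift.translationNumber_translate c]
      refine CircleDeg1Lift.translationNumber_eq_of_semiconj (f := h) fun x => ?_
      rw [CircleDeg1Lift.translate_apply, add_comm]
      exact hkc x
    rw [hcα]
    exact hkc

theorem RatIndep.irrational {d : ℕ} {α : Fin d → ℝ} (h : RatIndep α) (k : Fin d) :
    Irrational (α k) := by
  rintro ⟨q, hq⟩
  have := (h (Pi.single k 1) (-q) (by
    rw [Finset.sum_eq_single k (fun i _ hi => by simp [hi]) (by simp)]
    simp [hq])).2 k
  simp at this

theorem RatIndep.eq_of_sum_eq {d : ℕ} {α : Fin d → ℝ} (h : RatIndep α) {P : Finset (Fin d)}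
    (v w : P → ℕ) (m : ℤ) (hvw : ∑ i, v i * α i = ∑ i, w i * α i + m) : v = w := by
  let q : Fin d → ℚ := fun k => if hk : k ∈ P then (v ⟨k, hk⟩ : ℚ) - w ⟨k, hk⟩ else 0
  have hsum : ∑ k, (q k : ℝ) * α k = ∑ i : P, ((v i : ℝ) - w i) * α i := by
    rw [← Finset.sum_subset (Finset.subset_univ P) (fun k _ hk => by simp [q, hk]),
      ← Finset.sum_coe_sort]
    exact Finset.sum_congr rfl fun i _ => by simp [q]
  have h0 := (h q (-m) (by
    rw [hsum]
    simp_rw [sub_mul, Finset.sum_sub_distrib]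
    push_cast
    linarith)).2
  ext i
  have hi := h0 i
  simp only [q, i.2, dite_true, sub_eq_zero] at hi
  exact_mod_cast hi

end Semiconjugacy

/-- Corollary: the consistency condition may be replaced by submultiplicativity of `ω`
and comparability with the Hölder moduli. -/
theorem commuting_diffeos_conjugate_to_rotations_of_submultiplicative
    {d : ℕ} (hd : 2 ≤ d) (ωs : Fin d → ℝ → ℝ) (ω : ℝ → ℝ)
    (hmod : ∀ k, IsConcaveModulus (ωs k))
    (hprod : ∀ t ∈ Icc (0 : ℝ) 1, (∏ k, ωs k t) = t * ω t)
    (hlim : Tendsto ω (nhdsWithin 0 (Ioi 0)) (nhds 0))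
    (C : ℝ) (hC : 0 < C)
    (hsub : ∀ t₁ ∈ Icc (0 : ℝ) 1, ∀ t₂ ∈ Icc (0 : ℝ) 1, ω (t₁ * t₂) ≤ C * ω t₁ * ω t₂)
    (hcomp : ComparableWithHolder ωs)
    (f : Fin d → ℝ → ℝ)
    (hdiff : ∀ k, IsCircleDiffeoLift (f k))
    (hreg : ∀ k, OmegaCont (ωs k) (deriv (f k)))
    (hcomm : ∀ i j, ∀ x, f i (f j x) = f j (f i x))
    (α : Fin d → ℝ) (hα : ∀ k, HasRotationNumber (f k) (α k))
    (hindep : RatIndep α) :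
    SimultaneouslyConjToRotations f := by
  obtain ⟨h, hc, hsc⟩ := exists_semiconj_rotations hdiff hcomm hα
    (hindep.irrational ⟨0, by omega⟩)
  obtain ⟨P, a, hsum, hP⟩ := exists_holder_exponents hmod hprod hlim hC hsub hcomp
  have hdist : ∀ k : P, ∃ B, 0 ≤ B ∧ ∀ x y, |x - y| ≤ 1 →
      deriv (f k) x ≤ deriv (f k) y * Real.exp (B * |x - y| ^ a k) := by
    intro k
    obtain ⟨hak, δ, hδ, hle⟩ := hP k k.2
    exact (hdiff k).exists_deriv_le_mul_exp (hmod k).1 (hreg k) hak.1 hδ hle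
  choose B hB0 hB using hdist
  have hinj : Function.Injective h := by
    refine injective_of_semiconj_rotations (ι := P) (f := fun k => f k) (α := fun k => α k)
      (τ := fun k => a k) (C := ∑ k, B k) h hc (fun k => hdiff k) (fun k => hsc k)
      (fun k => (hP k k.2).1.1) (fun k => (hP k k.2).1.2.le) (by rwa [Finset.sum_coe_sort])
      (Finset.sum_nonneg fun k _ => hB0 k) (fun k x y hxy => (hB k x y hxy).trans ?_)
      (fun k => hindep.irrational k) hindep.eq_of_sum_eq
    have := (hdiff k).2.2.2 y
    have : B k ≤ ∑ k, B k := Finset.single_le_sum (fun k _ => hB0 k) (Finset.mem_univ k)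
    gcongr
  exact ⟨h, ⟨hc, h.monotone.strictMono_of_injective hinj, h.map_add_one⟩,
    fun k => ⟨α k, hsc k⟩⟩
end

section
/- Let d ≥ 2 be an integer, let α₁, …, α_d ∈ ℝ/ℤ be independent over the rationals, and let τ₁, …, τ_d ∈ (0,1) satisfy τ₁ + ⋯ + τ_d < 1. Then there exist pairwise commuting orientation-preserving circle diffeomorphisms f₁, …, f_d, not simultaneously topologically conjugate to rotations, such that for each k ∈ {1,…,d}, f_k is of class C^{1+τ_k} and the rotation number of f_k is α_k. -/
open Filter Set

/-- The lift to `ℝ` of the projective action of `diag(1, ρ)` on angles. -/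
noncomputable def projAngle (ρ u : ℝ) : ℝ :=
  u + Real.arctan ((ρ - 1) * Real.sin u * Real.cos u / (Real.cos u ^ 2 + ρ * Real.sin u ^ 2))

lemma cos_sq_add_mul_sin_sq_pos {c : ℝ} (hc : 0 < c) (u : ℝ) :
    0 < Real.cos u ^ 2 + c * Real.sin u ^ 2 := by
  have h := Real.sin_sq_add_cos_sq u
  rcases (sq_nonneg (Real.sin u)).eq_or_lt with h0 | h0
  · rw [← h0] at h ⊢; linarith
  · have := mul_pos hc h0
    have := sq_nonneg (Real.cos u)
    linarith

lemma abs_projAngle_sub_lt (ρ u : ℝ) : |projAngle ρ u - u| < Real.pi / 2 := by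
  rw [projAngle, add_sub_cancel_left, abs_lt]
  exact ⟨Real.neg_pi_div_two_lt_arctan _, Real.arctan_lt_pi_div_two _⟩

lemma projAngle_direction {ρ : ℝ} (hρ : 0 < ρ) (u : ℝ) :
    ∃ k : ℝ, 0 < k ∧ Real.cos (projAngle ρ u) = k * Real.cos u ∧
      Real.sin (projAngle ρ u) = k * (ρ * Real.sin u) := by
  have hD := cos_sq_add_mul_sin_sq_pos hρ u
  have h := Real.sin_sq_add_cos_sq u
  set D := Real.cos u ^ 2 + ρ * Real.sin u ^ 2 with hDdef
  set q := (ρ - 1) * Real.sin u * Real.cos u / D with hq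
  have hr : 0 < √(1 + q ^ 2) := Real.sqrt_pos.2 (by positivity)
  refine ⟨1 / (D * √(1 + q ^ 2)), by positivity, ?_, ?_⟩
  · rw [projAngle, Real.cos_add, ← hDdef, ← hq, Real.cos_arctan, Real.sin_arctan]
    have : Real.cos u - Real.sin u * q = Real.cos u / D := by
      rw [hq]; field_simp; rw [hDdef]; linear_combination (Real.cos u) * h
    calc _ = (Real.cos u - Real.sin u * q) / √(1 + q ^ 2) := by ring
      _ = _ := by rw [this]; field_simp
  · rw [projAngle, Real.sin_add, ← hDdef, ← hq, Real.cos_arctan, Real.sin_arctan]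
    have : Real.sin u + Real.cos u * q = ρ * Real.sin u / D := by
      rw [hq]; field_simp; rw [hDdef]; linear_combination (ρ * Real.sin u) * h
    calc _ = (Real.sin u + Real.cos u * q) / √(1 + q ^ 2) := by ring
      _ = _ := by rw [this]; field_simp

lemma projAngle_projAngle {ρ σ : ℝ} (hρ : 0 < ρ) (hσ : 0 < σ) (u : ℝ) :
    projAngle ρ (projAngle σ u) = projAngle (ρ * σ) u := by
  obtain ⟨k₁, hk₁, hc₁, hs₁⟩ := projAngle_direction hσ u
  obtain ⟨k₂, hk₂, hc₂, hs₂⟩ := projAngle_direction hρ (projAngle σ u)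
  obtain ⟨k, hk, hc, hs⟩ := projAngle_direction (mul_pos hρ hσ) u
  have h₁ := abs_lt.1 (abs_projAngle_sub_lt σ u)
  have h₂ := abs_lt.1 (abs_projAngle_sub_lt ρ (projAngle σ u))
  have h₃ := abs_lt.1 (abs_projAngle_sub_lt (ρ * σ) u)
  set x := projAngle ρ (projAngle σ u)
  set y := projAngle (ρ * σ) u
  have hx : k * Real.cos x = k₁ * k₂ * Real.cos y := by rw [hc₂, hc₁, hc]; ring
  have hx' : k * Real.sin x = k₁ * k₂ * Real.sin y := by rw [hs₂, hs₁, hs]; ring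
  have hkk : k = k₁ * k₂ := by
    have hxx := Real.sin_sq_add_cos_sq x
    have hyy := Real.sin_sq_add_cos_sq y
    have : k ^ 2 = (k₁ * k₂) ^ 2 := by
      calc k ^ 2 = (k * Real.sin x) ^ 2 + (k * Real.cos x) ^ 2 := by
            linear_combination (-k ^ 2) * hxx
        _ = _ := by rw [hx, hx']; linear_combination ((k₁ * k₂) ^ 2) * hyy
    exact (sq_eq_sq₀ hk.le (by positivity)).1 this
  rw [← hkk] at hx hx'
  have hx := mul_left_cancel₀ hk.ne' hx
  have hx' := mul_left_cancel₀ hk.ne' hx'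
  have hcos : Real.cos (x - y) = 1 := by
    rw [Real.cos_sub, hx, hx']
    linear_combination Real.sin_sq_add_cos_sq y
  have hpi := Real.pi_pos
  have := (Real.cos_eq_one_iff_of_lt_of_lt (by linarith) (by linarith)).1 hcos
  linarith

lemma projAngle_mul_pi (ρ : ℝ) (m : ℤ) : projAngle ρ (m * Real.pi) = m * Real.pi := by
  simp [projAngle, Real.sin_int_mul_pi]

lemma projAngle_add_mul_pi (ρ u : ℝ) (m : ℤ) :
    projAngle ρ (u + m * Real.pi) = projAngle ρ u + m * Real.pi := by
  have h : Real.sin (u + m * Real.pi) * Real.cos (u + m * Real.pi) = Real.sin u * Real.cos u := by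
    rw [Real.sin_add_int_mul_pi, Real.cos_add_int_mul_pi]
    rcases Int.even_or_odd m with h | h <;> rw [h.neg_one_zpow] <;> ring
  have h1 : Real.sin (u + m * Real.pi) ^ 2 = Real.sin u ^ 2 := by
    rw [Real.sin_add_int_mul_pi]
    rcases Int.even_or_odd m with h | h <;> rw [h.neg_one_zpow] <;> ring
  have h2 : Real.cos (u + m * Real.pi) ^ 2 = Real.cos u ^ 2 := by
    rw [Real.cos_add_int_mul_pi]
    rcases Int.even_or_odd m with h | h <;> rw [h.neg_one_zpow] <;> ring
  rw [projAngle, projAngle, mul_assoc, h, h1, h2]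
  ring_nf

lemma hasDerivAt_projAngle {ρ : ℝ} (hρ : 0 < ρ) (u : ℝ) :
    HasDerivAt (projAngle ρ) (ρ / (Real.cos u ^ 2 + ρ ^ 2 * Real.sin u ^ 2)) u := by
  have hD := cos_sq_add_mul_sin_sq_pos hρ u
  have hE := cos_sq_add_mul_sin_sq_pos (pow_pos hρ 2) u
  have h := Real.sin_sq_add_cos_sq u
  have hs := Real.hasDerivAt_sin u
  have hc := Real.hasDerivAt_cos u
  have hq := (((hs.const_mul (ρ - 1)).mul hc).div ((hc.pow 2).add ((hs.pow 2).const_mul ρ))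
    hD.ne').arctan
  have := (hasDerivAt_id u).add hq
  refine this.congr_deriv ?_
  simp only [Pi.add_apply, Pi.mul_apply, Pi.pow_apply, Pi.div_apply]
  have hF : 1 + ((ρ - 1) * Real.sin u * Real.cos u / (Real.cos u ^ 2 + ρ * Real.sin u ^ 2)) ^ 2
      = (Real.cos u ^ 2 + ρ ^ 2 * Real.sin u ^ 2) /
        (Real.cos u ^ 2 + ρ * Real.sin u ^ 2) ^ 2 := by
    field_simp
    have : Real.cos u ^ 2 = 1 - Real.sin u ^ 2 := by linarith
    simp only [this]
    ring
  rw [hF]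
  field_simp
  simp only [Nat.add_one_sub_one, pow_one, Nat.cast_ofNat]
  have h3 : Real.cos u ^ 2 = 1 - Real.sin u ^ 2 := by linarith
  have h4 : Real.cos u ^ 4 = (1 - Real.sin u ^ 2) ^ 2 := by rw [← h3]; ring
  ring_nf
  simp only [h3, h4]
  ring

/-- The length of `[0, s] ∩ ⋃ m : ℤ, [m, m + a]`. -/
noncomputable def stair (a s : ℝ) : ℝ := a * ⌊s⌋ + min (Int.fract s) a

lemma stair_eq_of_mem_left {a s : ℝ} (ha₁ : a < 1) {m : ℤ} (h₀ : m ≤ s) (h₁ : s ≤ m + a) :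
    stair a s = a * m + (s - m) := by
  have hfl : ⌊s⌋ = m := Int.floor_eq_iff.2 ⟨h₀, by linarith⟩
  rw [stair, Int.fract, hfl, min_eq_left (by linarith)]

lemma stair_eq_of_mem_right {a s : ℝ} (ha : 0 < a) {m : ℤ} (h₀ : m + a ≤ s) (h₁ : s ≤ m + 1) :
    stair a s = a * (m + 1) := by
  rcases h₁.eq_or_lt with h | h
  · have hfl : ⌊s⌋ = m + 1 := Int.floor_eq_iff.2 ⟨by push_cast; linarith, by push_cast; linarith⟩
    rw [stair, Int.fract, hfl, min_eq_left (by push_cast; linarith)]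
    push_cast
    linarith
  · have hfl : ⌊s⌋ = m := Int.floor_eq_iff.2 ⟨by linarith, h⟩
    rw [stair, Int.fract, hfl, min_eq_right (by linarith)]
    ring

lemma stair_add_int (a s : ℝ) (m : ℤ) : stair a (s + m) = stair a s + a * m := by
  simp only [stair, Int.floor_add_intCast, Int.fract_add_intCast]
  push_cast
  ring

lemma abs_stair_sub_le {a : ℝ} (ha : 0 < a) (ha₁ : a < 1) (s t : ℝ) :
    |stair a s - stair a t| ≤ |s - t| := by
  wlog hst : s ≤ t generalizing s t
  · rw [abs_sub_comm, abs_sub_comm s]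
    exact this t s (le_of_not_ge hst)
  rw [abs_sub_comm, abs_sub_comm s, abs_of_nonneg (sub_nonneg.2 hst)]
  have hfl := Int.floor_mono hst
  have es := Int.floor_add_fract s
  have et := Int.floor_add_fract t
  have hs0 := Int.fract_nonneg s
  have ht0 := Int.fract_nonneg t
  have hs1 := Int.fract_lt_one s
  have ht1 := Int.fract_lt_one t
  simp only [stair]
  rcases hfl.eq_or_lt with h | h
  · rw [h] at es ⊢
    rw [abs_le]
    constructor <;>
    rcases min_cases (Int.fract s) a with ⟨h1, h2⟩ | ⟨h1, h2⟩ <;>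
    rcases min_cases (Int.fract t) a with ⟨h3, h4⟩ | ⟨h3, h4⟩ <;>
    rw [h1, h3] <;> linarith
  · have hh : (⌊s⌋ : ℝ) + 1 ≤ ⌊t⌋ := by exact_mod_cast h
    have h1 : 0 ≤ a * ((⌊t⌋ : ℝ) - ⌊s⌋ - 1) := mul_nonneg ha.le (by linarith)
    have h2 : 0 ≤ (1 - a) * ((⌊t⌋ : ℝ) - ⌊s⌋ - 1) := mul_nonneg (by linarith) (by linarith)
    have := le_min ht0 ha.le
    have := min_le_right (Int.fract s) a
    have := min_le_left (Int.fract t) a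
    have : Int.fract s - min (Int.fract s) a ≤ 1 - a := by
      rcases min_cases (Int.fract s) a with ⟨h1, h2⟩ | ⟨h1, h2⟩ <;> rw [h1] <;> linarith
    rw [abs_le]
    constructor <;> linarith

lemma abs_stair_sub_le_mul {a : ℝ} (ha : 0 < a) (s t : ℝ) :
    |stair a s - stair a t| ≤ a * (|s - t| + 2) := by
  have es := Int.floor_add_fract s
  have et := Int.floor_add_fract t
  have hs0 := Int.fract_nonneg s
  have ht0 := Int.fract_nonneg t
  have hs1 := Int.fract_lt_one s
  have ht1 := Int.fract_lt_one t
  have h1 : |min (Int.fract s) a - min (Int.fract t) a| ≤ a := by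
    rw [abs_le]
    have := le_min hs0 ha.le
    have := le_min ht0 ha.le
    have := min_le_right (Int.fract s) a
    have := min_le_right (Int.fract t) a
    constructor <;> linarith
  have h2 : |(⌊s⌋ : ℝ) - ⌊t⌋| ≤ |s - t| + 1 := by
    have : (⌊s⌋ : ℝ) - ⌊t⌋ = (s - t) - (Int.fract s - Int.fract t) := by linarith
    rw [this]
    refine (abs_sub _ _).trans (by gcongr; rw [abs_le]; constructor <;> linarith)
  calc |stair a s - stair a t| = |a * ((⌊s⌋ : ℝ) - ⌊t⌋) +
        (min (Int.fract s) a - min (Int.fract t) a)| := by simp only [stair]; ring_nf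
    _ ≤ a * |(⌊s⌋ : ℝ) - ⌊t⌋| + a := (abs_add_le _ _).trans (by rw [abs_mul, abs_of_pos ha]; gcongr)
    _ ≤ _ := by nlinarith

/-- A diffeomorphism between intervals of lengths `a` and `b`, tangent to the identity at the
endpoints, minus the identity. -/
noncomputable def gapShift (a b v : ℝ) : ℝ :=
  b / Real.pi * projAngle (a / b) (Real.pi * v / a) - v

noncomputable def gapSlope (ρ u : ℝ) : ℝ :=
  (1 - ρ ^ 2) * Real.sin u ^ 2 / (Real.cos u ^ 2 + ρ ^ 2 * Real.sin u ^ 2)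

lemma hasDerivAt_gapShift {a b : ℝ} (ha : 0 < a) (hb : 0 < b) (v : ℝ) :
    HasDerivAt (gapShift a b) (gapSlope (a / b) (Real.pi * v / a)) v := by
  have hpi := Real.pi_pos
  have h1 := hasDerivAt_projAngle (div_pos ha hb) (Real.pi * v / a)
  have h2 : HasDerivAt (fun v : ℝ => Real.pi * v / a) (Real.pi / a) v := by
    simpa using ((hasDerivAt_id v).const_mul Real.pi).div_const a
  have h3 := ((h1.comp v h2).const_mul (b / Real.pi)).sub (hasDerivAt_id v)
  refine h3.congr_deriv ?_
  have hE := cos_sq_add_mul_sin_sq_pos (pow_pos (div_pos ha hb) 2) (Real.pi * v / a)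
  have h := Real.sin_sq_add_cos_sq (Real.pi * v / a)
  rw [gapSlope]
  have : b / Real.pi * (a / b / (Real.cos (Real.pi * v / a) ^ 2 +
      (a / b) ^ 2 * Real.sin (Real.pi * v / a) ^ 2) * (Real.pi / a)) =
      1 / (Real.cos (Real.pi * v / a) ^ 2 +
      (a / b) ^ 2 * Real.sin (Real.pi * v / a) ^ 2) := by
    generalize Real.cos (Real.pi * v / a) ^ 2 +
      (a / b) ^ 2 * Real.sin (Real.pi * v / a) ^ 2 = E
    field_simp
  rw [this, eq_div_iff hE.ne', sub_mul, div_mul_cancel₀ _ hE.ne']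
  linear_combination -h

lemma gapShift_mul_int {a : ℝ} (ha : 0 < a) (b : ℝ) (m : ℤ) :
    gapShift a b (a * m) = (b - a) * m := by
  have hpi := Real.pi_pos
  rw [gapShift, show Real.pi * (a * m) / a = m * Real.pi by field_simp, projAngle_mul_pi]
  field_simp

lemma gapShift_mul_int_add {a : ℝ} (ha : 0 < a) (b t : ℝ) (m : ℤ) :
    gapShift a b (a * m + t) = (b - a) * m + gapShift a b t := by
  have hpi := Real.pi_pos
  rw [gapShift, show Real.pi * (a * m + t) / a = Real.pi * t / a + m * Real.pi by field_simp; ring,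
    projAngle_add_mul_pi, gapShift]
  field_simp
  ring

lemma gapShift_zero (a b : ℝ) : gapShift a b 0 = 0 := by simp [gapShift, projAngle]

lemma add_gapShift_comp {a b c : ℝ} (ha : 0 < a) (hb : 0 < b) (hc : 0 < c) (t : ℝ) :
    (t + gapShift a b t) + gapShift b c (t + gapShift a b t) = t + gapShift a c t := by
  have hpi := Real.pi_pos
  have h1 : t + gapShift a b t = b / Real.pi * projAngle (a / b) (Real.pi * t / a) := by
    rw [gapShift]; ring
  rw [h1, gapShift, show Real.pi * (b / Real.pi * projAngle (a / b) (Real.pi * t / a)) / b =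
    projAngle (a / b) (Real.pi * t / a) by field_simp,
    projAngle_projAngle (div_pos hb hc) (div_pos ha hb), gapShift,
    show b / c * (a / b) = a / c by field_simp]
  ring

lemma abs_gapShift_sub_le {a b : ℝ} (ha : 0 < a) (hb : 0 < b) (v w : ℝ) :
    |gapShift a b v - gapShift a b w| ≤ |b / a - 1| * |v - w| + b := by
  have hpi := Real.pi_pos
  have h1 := abs_projAngle_sub_lt (a / b) (Real.pi * v / a)
  have h2 := abs_projAngle_sub_lt (a / b) (Real.pi * w / a)
  have h3 : gapShift a b v - gapShift a b w = (b / a - 1) * (v - w) + b / Real.pi *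
      ((projAngle (a / b) (Real.pi * v / a) - Real.pi * v / a) -
       (projAngle (a / b) (Real.pi * w / a) - Real.pi * w / a)) := by
    simp only [gapShift]
    field_simp
    ring
  rw [h3]
  refine (abs_add_le _ _).trans ?_
  rw [abs_mul, abs_mul]
  gcongr
  calc _ ≤ |b / Real.pi| * (Real.pi / 2 + Real.pi / 2) := by
        gcongr
        exact (abs_sub _ _).trans (by gcongr)
    _ = b := by rw [abs_of_pos (by positivity)]; field_simp; ring

lemma gapSlope_gt {ρ : ℝ} (hρ : 0 < ρ) (u : ℝ) : -1 < gapSlope ρ u := by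
  have hE := cos_sq_add_mul_sin_sq_pos (pow_pos hρ 2) u
  have h := Real.sin_sq_add_cos_sq u
  rw [gapSlope, lt_div_iff₀ hE]
  linarith

lemma gapSlope_int_mul_pi (ρ : ℝ) (m : ℤ) : gapSlope ρ (m * Real.pi) = 0 := by
  simp [gapSlope, Real.sin_int_mul_pi]

lemma abs_gapSlope_sub_le {ρ κ : ℝ} (hκ : 0 < κ) (hκ₁ : κ ≤ 1) (hκρ : κ ≤ ρ)
    {r : ℝ} (hr : r ∈ Ioo (0 : ℝ) 1)
    (u v : ℝ) : |gapSlope ρ u - gapSlope ρ v| ≤ |1 - ρ ^ 2| / κ ^ 4 * |u - v| ^ r := by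
  have hρ : 0 < ρ := hκ.trans_le hκρ
  have hEu := cos_sq_add_mul_sin_sq_pos (pow_pos hρ 2) u
  have hEv := cos_sq_add_mul_sin_sq_pos (pow_pos hρ 2) v
  have hu := Real.sin_sq_add_cos_sq u
  have hv := Real.sin_sq_add_cos_sq v
  have key : ∀ w, κ ^ 2 ≤ Real.cos w ^ 2 + ρ ^ 2 * Real.sin w ^ 2 := fun w => by
    have hw := Real.sin_sq_add_cos_sq w
    have h1 : κ ^ 2 ≤ ρ ^ 2 := by gcongr
    have h2 : κ ^ 2 ≤ 1 := pow_le_one₀ hκ.le hκ₁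
    nlinarith [sq_nonneg (Real.cos w), sq_nonneg (Real.sin w)]
  have hS : |Real.sin u ^ 2 - Real.sin v ^ 2| ≤ |u - v| ^ r := by
    have h1 : |Real.sin u ^ 2 - Real.sin v ^ 2| ≤ 1 := by
      rw [abs_le]
      constructor <;>
      nlinarith [sq_nonneg (Real.sin u), sq_nonneg (Real.sin v), sq_nonneg (Real.cos u),
        sq_nonneg (Real.cos v)]
    rcases le_total 1 |u - v| with h | h
    · exact h1.trans (Real.one_le_rpow h hr.1.le)
    · have h2 : Real.sin u ^ 2 - Real.sin v ^ 2 = Real.sin (u - v) * Real.sin (u + v) := by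
        rw [Real.sin_sub, Real.sin_add]
        have e1 : Real.cos u ^ 2 = 1 - Real.sin u ^ 2 := by linarith
        have e2 : Real.cos v ^ 2 = 1 - Real.sin v ^ 2 := by linarith
        ring_nf
        rw [e1, e2]
        ring
      rw [h2, abs_mul]
      calc _ ≤ |u - v| * 1 := by
            exact mul_le_mul Real.abs_sin_le_abs (Real.abs_sin_le_one _) (abs_nonneg _)
              (abs_nonneg _)
        _ = |u - v| ^ (1 : ℝ) := by simp
        _ ≤ _ := Real.rpow_le_rpow_of_exponent_ge' (abs_nonneg _) h hr.1.le hr.2.le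
  have : gapSlope ρ u - gapSlope ρ v = (1 - ρ ^ 2) * (Real.sin u ^ 2 - Real.sin v ^ 2) /
      ((Real.cos u ^ 2 + ρ ^ 2 * Real.sin u ^ 2) * (Real.cos v ^ 2 + ρ ^ 2 * Real.sin v ^ 2)) := by
    rw [gapSlope, gapSlope, div_sub_div _ _ hEu.ne' hEv.ne']
    congr 1
    rw [show Real.cos u ^ 2 = 1 - Real.sin u ^ 2 by linarith,
      show Real.cos v ^ 2 = 1 - Real.sin v ^ 2 by linarith]
    ring
  rw [this, abs_div, abs_mul, abs_of_pos (mul_pos hEu hEv), div_mul_eq_mul_div]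
  gcongr
  calc κ ^ 4 = κ ^ 2 * κ ^ 2 := by ring
    _ ≤ _ := by gcongr <;> exact key _

lemma stair_dichotomy {a : ℝ} (ha : 0 < a) (s : ℝ) :
    (∃ m : ℤ, m < s ∧ s < m + a) ∨ ∃ m : ℤ, stair a s = a * m := by
  rcases (Int.fract_nonneg s).eq_or_lt with h | h
  · exact Or.inr ⟨⌊s⌋, by rw [stair, ← h, min_eq_left ha.le, add_zero]⟩
  · have e := Int.floor_add_fract s
    rcases lt_or_ge (Int.fract s) a with h1 | h1
    · exact Or.inl ⟨⌊s⌋, by linarith, by linarith⟩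
    · refine Or.inr ⟨⌊s⌋ + 1, ?_⟩
      rw [stair, min_eq_right h1]
      push_cast
      ring

lemma gapSlope_eq_zero {a : ℝ} (ha : 0 < a) (ρ : ℝ) {s : ℝ} {m : ℤ} (h : stair a s = a * m) :
    gapSlope ρ (Real.pi * stair a s / a) = 0 := by
  rw [h, show Real.pi * (a * m) / a = m * Real.pi by field_simp, gapSlope_int_mul_pi]

lemma hasDerivAt_gapShift_stair {a b : ℝ} (ha : 0 < a) (ha₁ : a < 1) (hb : 0 < b) (s : ℝ) :
    HasDerivAt (fun s => gapShift a b (stair a s))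
      (gapSlope (a / b) (Real.pi * stair a s / a)) s := by
  have hZ := hasDerivAt_gapShift ha hb (stair a s)
  rcases stair_dichotomy ha s with ⟨m, h0, h1⟩ | ⟨m, hm⟩
  · have hM : HasDerivAt (stair a) 1 s := by
      have : HasDerivAt (fun s : ℝ => a * m + (s - m)) 1 s :=
        ((hasDerivAt_id s).sub_const (m : ℝ)).const_add (a * m)
      refine this.congr_of_eventuallyEq ?_
      filter_upwards [Ioo_mem_nhds h0 h1] with t ht
      exact stair_eq_of_mem_left ha₁ ht.1.le ht.2.le
    exact (hZ.comp s hM).congr_deriv (mul_one _)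
  · rw [gapSlope_eq_zero ha _ hm] at hZ ⊢
    have hM : Tendsto (stair a) (nhds s) (nhds (stair a s)) :=
      (LipschitzWith.of_dist_le_mul (K := 1) fun x y => by
        simpa [Real.dist_eq] using abs_stair_sub_le ha ha₁ x y).continuous.continuousAt
    rw [hasDerivAt_iff_isLittleO] at hZ ⊢
    simp only [smul_zero, sub_zero] at hZ ⊢
    refine (hZ.comp_tendsto hM).trans_isBigO (Asymptotics.IsBigO.of_bound 1 ?_)
    filter_upwards with t
    simpa using abs_stair_sub_le ha ha₁ t s

lemma add_gapShift_mem {a b t : ℝ} (ha : 0 < a) (hb : 0 < b) (h₀ : 0 ≤ t) (h₁ : t ≤ a) :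
    0 ≤ t + gapShift a b t ∧ t + gapShift a b t ≤ b := by
  have hd : ∀ v, HasDerivAt (fun v => v + gapShift a b v)
      (1 + gapSlope (a / b) (Real.pi * v / a)) v := fun v =>
    (hasDerivAt_id v).add (hasDerivAt_gapShift ha hb v)
  have hmono : Monotone fun v => v + gapShift a b v :=
    (strictMono_of_deriv_pos fun v => by
      rw [(hd v).deriv]
      linarith [gapSlope_gt (div_pos ha hb) (Real.pi * v / a)]).monotone
  have h2 : gapShift a b a = b - a := by simpa using gapShift_mul_int ha b 1
  have h3 := hmono h₀
  have h4 := hmono h₁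
  simp only [gapShift_zero, h2] at h3 h4
  constructor <;> linarith

section DisjointBumps

variable {ι : Type*} {Q q : ι → ℝ → ℝ} {C r : ℝ}

lemma abs_sum_sub_sum_le_of_disjoint (hC : 0 ≤ C)
    (hq : ∀ i x y, |q i x - q i y| ≤ C * |x - y| ^ r)
    (hd : ∀ i j x, q i x ≠ 0 → q j x ≠ 0 → i = j) (s : Finset ι) (x y : ℝ) :
    |∑ i ∈ s, q i x - ∑ i ∈ s, q i y| ≤ 2 * C * |x - y| ^ r := by
  classical
  have hpos : 0 ≤ C * |x - y| ^ r := mul_nonneg hC (Real.rpow_nonneg (abs_nonneg _) _)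
  rw [← Finset.sum_sub_distrib]
  have hcard : ∀ z, (s.filter fun i => q i z ≠ 0).card ≤ 1 := fun z =>
    Finset.card_le_one.2 fun i hi j hj =>
      hd i j z (Finset.mem_filter.1 hi).2 (Finset.mem_filter.1 hj).2
  set A := s.filter fun i => q i x ≠ 0 with hA
  set B := s.filter fun i => q i y ≠ 0 with hB
  have hsub : ∑ i ∈ s, (q i x - q i y) = ∑ i ∈ A ∪ B, (q i x - q i y) := by
    refine (Finset.sum_subset (Finset.union_subset (Finset.filter_subset _ _)
      (Finset.filter_subset _ _)) fun i hi hn => ?_).symm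
    have h1 : q i x = 0 := by
      by_contra h
      exact hn (Finset.mem_union_left _ (Finset.mem_filter.2 ⟨hi, h⟩))
    have h2 : q i y = 0 := by
      by_contra h
      exact hn (Finset.mem_union_right _ (Finset.mem_filter.2 ⟨hi, h⟩))
    rw [h1, h2, sub_zero]
  rw [hsub]
  have hAB : ((A ∪ B).card : ℝ) ≤ 2 := by
    have := Finset.card_union_le A B
    have h1 : A.card ≤ 1 := hcard x
    have h2 : B.card ≤ 1 := hcard y
    exact_mod_cast (show (A ∪ B).card ≤ 2 by omega)
  calc _ ≤ ∑ i ∈ A ∪ B, |q i x - q i y| := Finset.abs_sum_le_sum_abs _ _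
    _ ≤ (A ∪ B).card • (C * |x - y| ^ r) := Finset.sum_le_card_nsmul _ _ _ fun i _ => hq i x y
    _ ≤ 2 * C * |x - y| ^ r := by
        rw [nsmul_eq_mul]
        nlinarith

lemma summable_of_disjoint (hd : ∀ i j x, q i x ≠ 0 → q j x ≠ 0 → i = j) (x : ℝ) :
    Summable fun i => q i x := by
  refine summable_of_hasFiniteSupport (Set.Subsingleton.finite fun i hi j hj => ?_)
  exact hd i j x hi hj

lemma abs_tsum_sub_tsum_le_of_disjoint (hC : 0 ≤ C)
    (hq : ∀ i x y, |q i x - q i y| ≤ C * |x - y| ^ r)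
    (hd : ∀ i j x, q i x ≠ 0 → q j x ≠ 0 → i = j) (x y : ℝ) :
    |∑' i, q i x - ∑' i, q i y| ≤ 2 * C * |x - y| ^ r :=
  le_of_tendsto
    ((summable_of_disjoint hd x).hasSum.sub (summable_of_disjoint hd y).hasSum).abs
    (Eventually.of_forall fun s => by
      simpa [Finset.sum_sub_distrib] using abs_sum_sub_sum_le_of_disjoint hC hq hd s x y)

lemma hasDerivAt_tsum_of_disjoint (hC : 0 ≤ C) (hr : 0 < r)
    (hQ : ∀ i x, HasDerivAt (Q i) (q i x) x)
    (hq : ∀ i x y, |q i x - q i y| ≤ C * |x - y| ^ r)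
    (hd : ∀ i j x, q i x ≠ 0 → q j x ≠ 0 → i = j) (hs : ∀ x, Summable fun i => Q i x) (x : ℝ) :
    HasDerivAt (fun x => ∑' i, Q i x) (∑' i, q i x) x := by
  have hfin : ∀ (s : Finset ι) (y : ℝ),
      |∑ i ∈ s, (Q i y - Q i x - q i x * (y - x))| ≤ 2 * C * |y - x| ^ r * |y - x| := by
    intro s y
    have h1 : ∀ z ∈ uIcc x y, HasDerivWithinAt
        (fun z => ∑ i ∈ s, (Q i z - q i x * z)) (∑ i ∈ s, (q i z - q i x)) (uIcc x y) z := by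
      intro z _
      refine HasDerivAt.hasDerivWithinAt (HasDerivAt.fun_sum fun i _ => ?_)
      exact ((hQ i z).fun_sub ((hasDerivAt_id z).const_mul (q i x))).congr_deriv (by simp)
    have h2 : ∀ z ∈ uIcc x y, ‖∑ i ∈ s, (q i z - q i x)‖ ≤ 2 * C * |y - x| ^ r := by
      intro z hz
      rw [Finset.sum_sub_distrib, Real.norm_eq_abs]
      refine (abs_sum_sub_sum_le_of_disjoint hC hq hd s z x).trans ?_
      have := Set.abs_sub_left_of_mem_uIcc hz
      gcongr
    have h3 := (convex_uIcc x y).norm_image_sub_le_of_norm_hasDerivWithin_le h1 h2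
      left_mem_uIcc right_mem_uIcc
    rw [Real.norm_eq_abs, Real.norm_eq_abs, ← Finset.sum_sub_distrib] at h3
    convert h3 using 3
    ring
  have hlim : ∀ y, |∑' i, Q i y - ∑' i, Q i x - (∑' i, q i x) * (y - x)| ≤
      2 * C * |y - x| ^ r * |y - x| := fun y =>
    le_of_tendsto
      (((hs y).hasSum.sub (hs x).hasSum).sub
        ((summable_of_disjoint hd x).hasSum.mul_right (y - x))).abs
      (Eventually.of_forall fun s => hfin s y)
  rw [hasDerivAt_iff_isLittleO]
  have hz : Tendsto (fun y => 2 * C * |y - x| ^ r) (nhds x) (nhds 0) := by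
    have : ContinuousAt (fun y : ℝ => 2 * C * |y - x| ^ r) x :=
      continuousAt_const.mul (ContinuousAt.rpow_const (by fun_prop) (Or.inr hr.le))
    simpa [ContinuousAt, Real.zero_rpow hr.ne'] using this
  refine Asymptotics.isLittleO_iff.2 fun c hc => ?_
  filter_upwards [hz.eventually (ge_mem_nhds hc)] with y hy
  rw [smul_eq_mul, mul_comm (y - x), Real.norm_eq_abs, Real.norm_eq_abs]
  exact (hlim y).trans (by gcongr)

end DisjointBumps

/-- Data for blowing up a free orbit of a group of circle rotations: the group element `g`
rotates by `angle g`, and the orbit point `angle g` is replaced by a gap of length `len g`. -/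
structure DenjoyData (G : Type*) [AddCommGroup G] where
  angle : G →+ ℝ
  len : G → ℝ
  len_pos : ∀ g, 0 < len g
  summable_len : Summable len
  tsum_len_lt_one : ∑' g, len g < 1
  free : ∀ g (m : ℤ), angle g = m → g = 0

namespace DenjoyData

variable {G : Type*} [AddCommGroup G] (D : DenjoyData G)

lemma len_lt_one (g : G) : D.len g < 1 :=
  (D.summable_len.le_tsum g fun h _ => (D.len_pos h).le).trans_lt D.tsum_len_lt_one

/-- The left-continuous map sending a point to the left endpoint of its blow-up. -/
noncomputable def blow (y : ℝ) : ℝ :=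
  (1 - ∑' g, D.len g) * y + ∑' g, D.len g * ((⌈y - D.angle g⌉ : ℝ) - ⌈-D.angle g⌉)

/-- The right-continuous map sending a point to the right endpoint of its blow-up. -/
noncomputable def blowRight (y : ℝ) : ℝ :=
  (1 - ∑' g, D.len g) * y + ∑' g, D.len g * ((⌊y - D.angle g⌋ : ℝ) + 1 - ⌈-D.angle g⌉)

lemma abs_ceil_sub_ceil_le (y t : ℝ) : |(⌈y - t⌉ : ℝ) - ⌈-t⌉| ≤ |y| + 1 := by
  have h1 := Int.le_ceil (y - t)
  have h2 := Int.ceil_lt_add_one (y - t)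
  have h3 := Int.le_ceil (-t)
  have h4 := Int.ceil_lt_add_one (-t)
  have := le_abs_self y
  have := neg_abs_le y
  rw [abs_le]
  constructor <;> linarith

lemma abs_floor_add_one_sub_ceil_le (y t : ℝ) : |(⌊y - t⌋ : ℝ) + 1 - ⌈-t⌉| ≤ |y| + 1 := by
  have h1 := Int.floor_le (y - t)
  have h2 := Int.lt_floor_add_one (y - t)
  have h3 := Int.le_ceil (-t)
  have h4 := Int.ceil_lt_add_one (-t)
  have := le_abs_self y
  have := neg_abs_le y
  rw [abs_le]
  constructor <;> linarith

lemma norm_len_mul_le (g : G) {c b : ℝ} (h : |c| ≤ b) : ‖D.len g * c‖ ≤ D.len g * b := by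
  rw [norm_mul, Real.norm_of_nonneg (D.len_pos g).le]
  exact mul_le_mul_of_nonneg_left h (D.len_pos g).le

lemma summable_blow (y : ℝ) :
    Summable fun g => D.len g * ((⌈y - D.angle g⌉ : ℝ) - ⌈-D.angle g⌉) :=
  (D.summable_len.mul_right (|y| + 1)).of_norm_bounded
    fun g => D.norm_len_mul_le g (abs_ceil_sub_ceil_le _ _)

lemma summable_blowRight (y : ℝ) :
    Summable fun g => D.len g * ((⌊y - D.angle g⌋ : ℝ) + 1 - ⌈-D.angle g⌉) :=
  (D.summable_len.mul_right (|y| + 1)).of_norm_bounded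
    fun g => D.norm_len_mul_le g (abs_floor_add_one_sub_ceil_le _ _)

lemma blow_zero : D.blow 0 = 0 := by simp [blow]

lemma blow_add_int (y : ℝ) (m : ℤ) : D.blow (y + m) = D.blow y + m := by
  have : ∀ g, D.len g * ((⌈y + m - D.angle g⌉ : ℝ) - ⌈-D.angle g⌉) =
      D.len g * ((⌈y - D.angle g⌉ : ℝ) - ⌈-D.angle g⌉) + D.len g * m := fun g => by
    rw [show y + m - D.angle g = y - D.angle g + m by ring, Int.ceil_add_intCast]
    push_cast
    ring
  simp only [blow, this]
  rw [(D.summable_blow y).tsum_add (D.summable_len.mul_right _), tsum_mul_right]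
  ring

lemma blow_int (m : ℤ) : D.blow m = m := by
  simpa [D.blow_zero] using D.blow_add_int 0 m

lemma blowRight_le_blow {y z : ℝ} (h : y < z) :
    D.blowRight y + (1 - ∑' g, D.len g) * (z - y) ≤ D.blow z := by
  have : ∑' g, D.len g * ((⌊y - D.angle g⌋ : ℝ) + 1 - ⌈-D.angle g⌉) ≤
      ∑' g, D.len g * ((⌈z - D.angle g⌉ : ℝ) - ⌈-D.angle g⌉) := by
    refine (D.summable_blowRight y).tsum_le_tsum (fun g => ?_) (D.summable_blow z)
    refine mul_le_mul_of_nonneg_left (sub_le_sub_right ?_ _) (D.len_pos g).le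
    have h1 : ⌊y - D.angle g⌋ < ⌈z - D.angle g⌉ :=
      Int.lt_ceil.2 ((Int.floor_le _).trans_lt (by linarith))
    exact_mod_cast h1
  rw [blowRight, blow]
  linarith

lemma blowRight_lt_blow {y z : ℝ} (h : y < z) : D.blowRight y < D.blow z := by
  have := D.blowRight_le_blow h
  have := mul_pos (sub_pos.2 D.tsum_len_lt_one) (sub_pos.2 h)
  linarith

lemma blowRight_sub_blow (y : ℝ) : D.blowRight y - D.blow y =
    ∑' g, D.len g * ((⌊y - D.angle g⌋ : ℝ) + 1 - ⌈y - D.angle g⌉) := by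
  rw [blow, blowRight, add_sub_add_left_eq_sub,
    ← (D.summable_blowRight y).tsum_sub (D.summable_blow y)]
  congr with g
  ring

lemma floor_add_one_eq_ceil {s : ℝ} (h : ∀ m : ℤ, s ≠ m) : ⌊s⌋ + 1 = ⌈s⌉ := by
  symm
  rw [Int.ceil_eq_iff]
  push_cast
  have := lt_of_le_of_ne (Int.floor_le s) (h _).symm
  have := Int.lt_floor_add_one s
  constructor <;> linarith

lemma eq_of_angle_add_int {g h : G} {m n : ℤ} (e : D.angle g + m = D.angle h + n) : g = h := by
  have : g - h = 0 := D.free _ (n - m) (by rw [map_sub]; push_cast; linarith)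
  exact sub_eq_zero.1 this

lemma blowRight_angle_add_int (g : G) (m : ℤ) :
    D.blowRight (D.angle g + m) = D.blow (D.angle g + m) + D.len g := by
  have h := D.blowRight_sub_blow (D.angle g + m)
  rw [tsum_eq_single g] at h
  · have : D.angle g + m - D.angle g = m := by ring
    rw [this] at h
    simp at h
    linarith
  · intro k hk
    rw [← floor_add_one_eq_ceil]
    · push_cast; ring
    · intro n hn
      exact hk (D.eq_of_angle_add_int (m := n) (n := m) (by linarith))

lemma blowRight_eq_blow {y : ℝ} (h : ∀ g (m : ℤ), y ≠ D.angle g + m) :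
    D.blowRight y = D.blow y := by
  rw [← sub_eq_zero, D.blowRight_sub_blow]
  convert tsum_zero with g
  rw [← floor_add_one_eq_ceil fun m hm => h g m (by linarith)]
  push_cast
  ring

lemma blow_le_blowRight (y : ℝ) : D.blow y ≤ D.blowRight y := by
  rw [← sub_nonneg, D.blowRight_sub_blow]
  refine tsum_nonneg fun g => mul_nonneg (D.len_pos g).le ?_
  have := Int.ceil_le_floor_add_one (y - D.angle g)
  rw [sub_nonneg]
  exact_mod_cast this

lemma blow_strictMono : StrictMono D.blow := fun _ _ h =>
  (D.blow_le_blowRight _).trans_lt (D.blowRight_lt_blow h)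

lemma tendsto_blow_left (y : ℝ) : Tendsto D.blow (nhdsWithin y (Iio y)) (nhds (D.blow y)) := by
  refine Tendsto.add ?_ ?_
  · exact (Continuous.tendsto (by fun_prop) y).mono_left nhdsWithin_le_nhds
  refine tendsto_tsum_of_dominated_convergence (D.summable_len.mul_right (|y| + 2)) (fun g => ?_) ?_
  · refine Tendsto.congr' ?_ tendsto_const_nhds
    have h1 := Int.ceil_lt_add_one (y - D.angle g)
    filter_upwards [Ioo_mem_nhdsLT (show ⌈y - D.angle g⌉ - 1 + D.angle g < y by linarith)]
      with z hz
    have : ⌈z - D.angle g⌉ = ⌈y - D.angle g⌉ := by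
      rw [Int.ceil_eq_iff]
      have := Int.le_ceil (y - D.angle g)
      have := hz.1
      have := hz.2
      constructor <;> linarith
    rw [this]
  · filter_upwards [Ioo_mem_nhdsLT (show y - 1 < y by linarith)] with z hz g
    refine D.norm_len_mul_le g ((abs_ceil_sub_ceil_le _ _).trans ?_)
    have : |z| ≤ |y| + |z - y| := by simpa using abs_add_le y (z - y)
    have : |z - y| ≤ 1 := abs_le.2 ⟨by linarith [hz.1], by linarith [hz.2]⟩
    linarith

lemma tendsto_blowRight_right (y : ℝ) :
    Tendsto D.blowRight (nhdsWithin y (Ioi y)) (nhds (D.blowRight y)) := by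
  refine Tendsto.add ?_ ?_
  · exact (Continuous.tendsto (by fun_prop) y).mono_left nhdsWithin_le_nhds
  refine tendsto_tsum_of_dominated_convergence (D.summable_len.mul_right (|y| + 2)) (fun g => ?_) ?_
  · refine Tendsto.congr' ?_ tendsto_const_nhds
    have h1 := Int.lt_floor_add_one (y - D.angle g)
    filter_upwards [Ioo_mem_nhdsGT (show y < ⌊y - D.angle g⌋ + 1 + D.angle g by linarith)]
      with z hz
    have : ⌊z - D.angle g⌋ = ⌊y - D.angle g⌋ := by
      rw [Int.floor_eq_iff]
      have := Int.floor_le (y - D.angle g)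
      have := hz.1
      have := hz.2
      constructor <;> linarith
    rw [this]
  · filter_upwards [Ioo_mem_nhdsGT (show y < y + 1 by linarith)] with z hz g
    refine D.norm_len_mul_le g ((abs_floor_add_one_sub_ceil_le _ _).trans ?_)
    have : |z| ≤ |y| + |z - y| := by simpa using abs_add_le y (z - y)
    have : |z - y| ≤ 1 := abs_le.2 ⟨by linarith [hz.1], by linarith [hz.2]⟩
    linarith

lemma exists_blow_le_le_blowRight (x : ℝ) : ∃ y, D.blow y ≤ x ∧ x ≤ D.blowRight y := by
  set S := {y | D.blow y ≤ x}
  have hne : S.Nonempty := ⟨⌊x⌋, by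
    exact (D.blow_int _).le.trans (Int.floor_le x)⟩
  have hbdd : BddAbove S := ⟨⌈x⌉, fun y hy => by
    by_contra! h
    have h1 := D.blow_strictMono h
    rw [blow_int] at h1
    exact absurd (hy.trans (Int.le_ceil x)) h1.not_ge⟩
  refine ⟨sSup S, ?_, ?_⟩
  · refine le_of_tendsto (D.tendsto_blow_left (sSup S)) ?_
    filter_upwards [self_mem_nhdsWithin] with z hz
    obtain ⟨w, hw, hzw⟩ := exists_lt_of_lt_csSup hne hz
    exact (D.blow_strictMono hzw).le.trans hw
  · refine ge_of_tendsto (D.tendsto_blowRight_right (sSup S)) ?_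
    filter_upwards [self_mem_nhdsWithin] with z hz
    by_contra! h
    exact (le_csSup hbdd ((D.blow_le_blowRight z).trans h.le)).not_gt hz

lemma exists_eq_blow_add (x : ℝ) : ∃ y t, x = D.blow y + t ∧
    (t = 0 ∨ ∃ (g : G) (m : ℤ), y = D.angle g + m ∧ 0 ≤ t ∧ t ≤ D.len g) := by
  obtain ⟨y, h₀, h₁⟩ := D.exists_blow_le_le_blowRight x
  refine ⟨y, x - D.blow y, by ring, ?_⟩
  by_cases h : ∃ (g : G) (m : ℤ), y = D.angle g + m
  · obtain ⟨g, m, rfl⟩ := h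
    rw [D.blowRight_angle_add_int] at h₁
    exact Or.inr ⟨g, m, rfl, by linarith, by linarith⟩
  · push Not at h
    rw [D.blowRight_eq_blow h] at h₁
    left
    linarith

/-- The displacement contributed by the gaps over the translates of `angle g`. -/
noncomputable def gapTerm (e g : G) (x : ℝ) : ℝ :=
  gapShift (D.len g) (D.len (g + e)) (stair (D.len g) (x - D.blow (D.angle g)))

noncomputable def gapTermSlope (e g : G) (x : ℝ) : ℝ :=
  gapSlope (D.len g / D.len (g + e))
    (Real.pi * stair (D.len g) (x - D.blow (D.angle g)) / D.len g)

/-- The blow-up of the rotation of angle `angle e`. -/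
noncomputable def shift (e : G) (x : ℝ) : ℝ :=
  x + D.blow (D.angle e) + ∑' g, (D.gapTerm e g x - D.gapTerm e g 0)

lemma stair_blow_of_ne {g : G} {y t : ℝ} (hy : ∀ m : ℤ, y - D.angle g ≠ m) (ht : 0 ≤ t)
    (hty : D.blow y + t ≤ D.blowRight y) :
    stair (D.len g) (D.blow y + t - D.blow (D.angle g)) = D.len g * ⌈y - D.angle g⌉ := by
  have h1 := lt_of_le_of_ne (Int.floor_le (y - D.angle g)) (hy _).symm
  have h2 := Int.lt_floor_add_one (y - D.angle g)
  have h3 := D.blowRight_lt_blow (show D.angle g + ⌊y - D.angle g⌋ < y by linarith)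
  have h4 := D.blowRight_lt_blow
    (show y < D.angle g + ((⌊y - D.angle g⌋ + 1 : ℤ) : ℝ) by push_cast; linarith)
  rw [D.blowRight_angle_add_int, D.blow_add_int] at h3
  rw [D.blow_add_int] at h4
  push_cast at h4
  rw [← floor_add_one_eq_ceil hy]
  push_cast
  exact stair_eq_of_mem_right (D.len_pos g) (by linarith) (by linarith)

lemma stair_blow_angle_add_int (g : G) (m : ℤ) {t : ℝ} (h₀ : 0 ≤ t) (h₁ : t ≤ D.len g) :
    stair (D.len g) (D.blow (D.angle g + m) + t - D.blow (D.angle g)) = D.len g * m + t := by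
  have : D.blow (D.angle g + m) + t - D.blow (D.angle g) = m + t := by
    rw [D.blow_add_int]; ring
  rw [this, stair_eq_of_mem_left (D.len_lt_one g) (by linarith) (by linarith)]
  ring

lemma gapTerm_of_ne (e : G) {g : G} {y t : ℝ} (hy : ∀ m : ℤ, y - D.angle g ≠ m) (ht : 0 ≤ t)
    (hty : D.blow y + t ≤ D.blowRight y) :
    D.gapTerm e g (D.blow y + t) = (D.len (g + e) - D.len g) * ⌈y - D.angle g⌉ := by
  rw [gapTerm, D.stair_blow_of_ne hy ht hty, gapShift_mul_int (D.len_pos g)]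

lemma gapTerm_angle_add_int (e g : G) (m : ℤ) {t : ℝ} (h₀ : 0 ≤ t) (h₁ : t ≤ D.len g) :
    D.gapTerm e g (D.blow (D.angle g + m) + t) =
      (D.len (g + e) - D.len g) * m + gapShift (D.len g) (D.len (g + e)) t := by
  rw [gapTerm, D.stair_blow_angle_add_int g m h₀ h₁, gapShift_mul_int_add (D.len_pos g)]

lemma gapTerm_blow (e g : G) (y : ℝ) :
    D.gapTerm e g (D.blow y) = (D.len (g + e) - D.len g) * ⌈y - D.angle g⌉ := by
  by_cases h : ∀ m : ℤ, y - D.angle g ≠ m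
  · simpa using D.gapTerm_of_ne e h le_rfl (by simpa using D.blow_le_blowRight y)
  · push Not at h
    obtain ⟨m, hm⟩ := h
    obtain rfl : y = D.angle g + m := by linarith
    simpa [gapShift_zero] using D.gapTerm_angle_add_int e g m le_rfl (D.len_pos g).le

lemma gapTerm_zero (e g : G) :
    D.gapTerm e g 0 = (D.len (g + e) - D.len g) * ⌈-D.angle g⌉ := by
  simpa [D.blow_zero] using D.gapTerm_blow e g 0

lemma summable_len_add (e : G) : Summable fun g => D.len (g + e) :=
  (Equiv.addRight e).summable_iff.2 D.summable_len

lemma summable_shift_blow (e : G) (y : ℝ) : Summable fun g =>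
    (D.len (g + e) - D.len g) * ((⌈y - D.angle g⌉ : ℝ) - ⌈-D.angle g⌉) := by
  refine (((D.summable_len_add e).add D.summable_len).mul_right (|y| + 1)).of_norm_bounded
    fun g => ?_
  rw [norm_mul]
  have h1 := D.len_pos g
  have h2 := D.len_pos (g + e)
  refine mul_le_mul ?_ (abs_ceil_sub_ceil_le _ _) (norm_nonneg _) (by linarith)
  rw [Real.norm_eq_abs, abs_le]
  constructor <;> linarith

lemma blow_add_angle (e : G) (y : ℝ) : D.blow (y + D.angle e) = D.blow y + D.blow (D.angle e) +
    ∑' g, (D.len (g + e) - D.len g) * ((⌈y - D.angle g⌉ : ℝ) - ⌈-D.angle g⌉) := by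
  have key : ∀ z, D.blow (z + D.angle e) = (1 - ∑' g, D.len g) * (z + D.angle e) +
      ∑' g, D.len (g + e) * ((⌈z - D.angle g⌉ : ℝ) - ⌈-D.angle (g + e)⌉) := fun z => by
    rw [blow, ← (Equiv.addRight e).tsum_eq
      fun g => D.len g * ((⌈z + D.angle e - D.angle g⌉ : ℝ) - ⌈-D.angle g⌉)]
    simp
  have sm : ∀ z, Summable fun g =>
      D.len (g + e) * ((⌈z - D.angle g⌉ : ℝ) - ⌈-D.angle (g + e)⌉) := fun z => by
    convert (Equiv.addRight e).summable_iff.2 (D.summable_blow (z + D.angle e)) with g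
    simp
  have key0 := key 0
  have sm0 := sm 0
  simp only [zero_add, zero_sub] at key0 sm0
  rw [key, key0, blow]
  have : ∑' g, D.len (g + e) * ((⌈y - D.angle g⌉ : ℝ) - ⌈-D.angle (g + e)⌉) =
      ∑' g, (D.len g * ((⌈y - D.angle g⌉ : ℝ) - ⌈-D.angle g⌉) +
        (D.len (g + e) * ((⌈-D.angle g⌉ : ℝ) - ⌈-D.angle (g + e)⌉) +
        (D.len (g + e) - D.len g) * ((⌈y - D.angle g⌉ : ℝ) - ⌈-D.angle g⌉))) := by
    congr with g
    ring
  rw [this, (D.summable_blow y).tsum_add (sm0.add (D.summable_shift_blow e y)),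
    sm0.tsum_add (D.summable_shift_blow e y)]
  ring

lemma shift_blow (e : G) (y : ℝ) : D.shift e (D.blow y) = D.blow (y + D.angle e) := by
  simp only [shift, gapTerm_blow, gapTerm_zero, ← mul_sub]
  rw [D.blow_add_angle]

lemma shift_blow_add (e g : G) (m : ℤ) {t : ℝ} (h₀ : 0 ≤ t) (h₁ : t ≤ D.len g) :
    D.shift e (D.blow (D.angle g + m) + t) =
      D.blow (D.angle (g + e) + m) + (t + gapShift (D.len g) (D.len (g + e)) t) := by
  classical
  have key : ∀ k, D.gapTerm e k (D.blow (D.angle g + m) + t) - D.gapTerm e k 0 =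
      (D.len (k + e) - D.len k) * ((⌈D.angle g + m - D.angle k⌉ : ℝ) - ⌈-D.angle k⌉) +
        (Pi.single g (gapShift (D.len g) (D.len (g + e)) t) : G → ℝ) k := fun k => by
    rw [gapTerm_zero]
    by_cases hk : k = g
    · subst hk
      rw [D.gapTerm_angle_add_int e k m h₀ h₁, Pi.single_eq_same, add_sub_cancel_left,
        Int.ceil_intCast]
      ring
    · rw [D.gapTerm_of_ne e (fun n hn => hk (D.eq_of_angle_add_int (m := n) (n := m)
        (by linarith))) h₀ (by rw [D.blowRight_angle_add_int]; linarith), Pi.single_eq_of_ne hk]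
      ring
  rw [shift, show D.angle (g + e) + m = D.angle g + m + D.angle e by rw [map_add]; ring,
    D.blow_add_angle]
  simp only [key]
  rw [(D.summable_shift_blow e _).tsum_add (hasSum_pi_single g _).summable, tsum_pi_single]
  ring

lemma shift_shift (e e' : G) (x : ℝ) : D.shift e' (D.shift e x) = D.shift (e + e') x := by
  obtain ⟨y, t, rfl, rfl | ⟨g, m, rfl, h₀, h₁⟩⟩ := D.exists_eq_blow_add x
  · simp only [add_zero, shift_blow, map_add, add_assoc]
  · have hlen := D.len_pos
    obtain ⟨h₂, h₃⟩ := add_gapShift_mem (hlen g) (hlen (g + e)) h₀ h₁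
    rw [D.shift_blow_add e g m h₀ h₁, D.shift_blow_add e' (g + e) m h₂ h₃,
      D.shift_blow_add (e + e') g m h₀ h₁,
      add_gapShift_comp (hlen g) (hlen (g + e)) (hlen (g + e + e')), add_assoc]

lemma hasDerivAt_gapTerm (e g : G) (x : ℝ) :
    HasDerivAt (D.gapTerm e g) (D.gapTermSlope e g x) x :=
  (hasDerivAt_gapShift_stair (D.len_pos g) (D.len_lt_one g) (D.len_pos (g + e))
    _).comp_sub_const x _

lemma exists_mem_gap {e g : G} {x : ℝ} (h : D.gapTermSlope e g x ≠ 0) :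
    ∃ m : ℤ, D.blow (D.angle g + m) < x ∧ x < D.blowRight (D.angle g + m) := by
  rcases stair_dichotomy (D.len_pos g) (x - D.blow (D.angle g)) with ⟨m, h0, h1⟩ | ⟨m, hm⟩
  · refine ⟨m, ?_, ?_⟩
    · rw [D.blow_add_int]; linarith
    · rw [D.blowRight_angle_add_int, D.blow_add_int]; linarith
  · exact absurd (gapSlope_eq_zero (D.len_pos g) _ hm) h

lemma gapTermSlope_disjoint (e g h : G) (x : ℝ) (hg : D.gapTermSlope e g x ≠ 0)
    (hh : D.gapTermSlope e h x ≠ 0) : g = h := by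
  obtain ⟨m, h1, h2⟩ := D.exists_mem_gap hg
  obtain ⟨n, h3, h4⟩ := D.exists_mem_gap hh
  rcases lt_trichotomy (D.angle g + m) (D.angle h + n) with hl | he | hl
  · linarith [D.blowRight_lt_blow hl]
  · exact D.eq_of_angle_add_int he
  · linarith [D.blowRight_lt_blow hl]

lemma summable_gapTerm (e : G) (x : ℝ) :
    Summable fun g => D.gapTerm e g x - D.gapTerm e g 0 := by
  refine ((((D.summable_len_add e).add D.summable_len).mul_right (|x| + 2)).add
    (D.summable_len_add e)).of_norm_bounded fun g => ?_
  have h1 := D.len_pos g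
  have h2 := D.len_pos (g + e)
  refine (abs_gapShift_sub_le h1 h2 _ _).trans (add_le_add_left ?_ _)
  calc _ ≤ |D.len (g + e) / D.len g - 1| * (D.len g * (|x| + 2)) := by
        refine mul_le_mul_of_nonneg_left ?_ (abs_nonneg _)
        simpa using abs_stair_sub_le_mul h1 (x - D.blow (D.angle g)) (0 - D.blow (D.angle g))
    _ = |D.len (g + e) - D.len g| * (|x| + 2) := by
        rw [show D.len (g + e) / D.len g - 1 = (D.len (g + e) - D.len g) / D.len g by field_simp,
          abs_div, abs_of_pos h1]
        field_simp
    _ ≤ _ := by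
        refine mul_le_mul_of_nonneg_right ?_ (by positivity)
        rw [abs_le]
        constructor <;> linarith

lemma shift_add_one (e : G) (x : ℝ) : D.shift e (x + 1) = D.shift e x + 1 := by
  have key : ∀ g, D.gapTerm e g (x + 1) - D.gapTerm e g 0 =
      (D.gapTerm e g x - D.gapTerm e g 0) + (D.len (g + e) - D.len g) := fun g => by
    have h := stair_add_int (D.len g) (x - D.blow (D.angle g)) 1
    rw [gapTerm, show x + 1 - D.blow (D.angle g) = x - D.blow (D.angle g) + (1 : ℤ) by
      push_cast; ring, h, add_comm (stair _ _), gapShift_mul_int_add (D.len_pos g)]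
    simp only [gapTerm]
    push_cast
    ring
  simp only [shift, key]
  rw [(D.summable_gapTerm e x).tsum_add ((D.summable_len_add e).sub D.summable_len),
    (D.summable_len_add e).tsum_sub D.summable_len,
    show ∑' g, D.len (g + e) = ∑' g, D.len g from (Equiv.addRight e).tsum_eq D.len]
  ring

section Regularity

variable {e : G} {C κ r : ℝ}

lemma abs_gapTermSlope_sub_le (hr : r ∈ Ioo (0 : ℝ) 1) (hκ : 0 < κ) (hκ₁ : κ ≤ 1)
    (hκe : ∀ g, κ ≤ D.len g / D.len (g + e))
    (hCe : ∀ g, |1 - (D.len g / D.len (g + e)) ^ 2| ≤ C * D.len g ^ r) (g : G) (x y : ℝ) :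
    |D.gapTermSlope e g x - D.gapTermSlope e g y| ≤ C * Real.pi ^ r / κ ^ 4 * |x - y| ^ r := by
  have hpi := Real.pi_pos
  have h1 := D.len_pos g
  refine (abs_gapSlope_sub_le hκ hκ₁ (hκe g) hr _ _).trans ?_
  have h2 := abs_stair_sub_le h1 (D.len_lt_one g) (x - D.blow (D.angle g)) (y - D.blow (D.angle g))
  rw [sub_sub_sub_cancel_right] at h2
  rw [← sub_div, ← mul_sub, abs_div, abs_mul, abs_of_pos hpi, abs_of_pos h1]
  have hr0 := hr.1.le
  calc _ ≤ C * D.len g ^ r / κ ^ 4 * (Real.pi * |x - y| / D.len g) ^ r := by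
        have h3 : 0 ≤ C * D.len g ^ r := (abs_nonneg _).trans (hCe g)
        gcongr
        exact hCe g
    _ = _ := by
        rw [Real.div_rpow (by positivity) h1.le, Real.mul_rpow hpi.le (abs_nonneg _)]
        have := Real.rpow_pos_of_pos h1 r
        field_simp

lemma hasDerivAt_shift (hr : r ∈ Ioo (0 : ℝ) 1) (hC : 0 ≤ C) (hκ : 0 < κ) (hκ₁ : κ ≤ 1)
    (hκe : ∀ g, κ ≤ D.len g / D.len (g + e))
    (hCe : ∀ g, |1 - (D.len g / D.len (g + e)) ^ 2| ≤ C * D.len g ^ r) (x : ℝ) :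
    HasDerivAt (D.shift e) (1 + ∑' g, D.gapTermSlope e g x) x := by
  have := hasDerivAt_tsum_of_disjoint (by positivity) hr.1
    (fun g x => (D.hasDerivAt_gapTerm e g x).sub_const (D.gapTerm e g 0))
    (D.abs_gapTermSlope_sub_le hr hκ hκ₁ hκe hCe) (D.gapTermSlope_disjoint e)
    (D.summable_gapTerm e) x
  exact ((hasDerivAt_id x).add_const _).add this

lemma one_add_tsum_gapTermSlope_pos (e : G) (x : ℝ) : 0 < 1 + ∑' g, D.gapTermSlope e g x := by
  by_cases h : ∃ g, D.gapTermSlope e g x ≠ 0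
  · obtain ⟨g, hg⟩ := h
    rw [tsum_eq_single g fun k hk => by
      by_contra hk'
      exact hk (D.gapTermSlope_disjoint e k g x hk' hg)]
    have := gapSlope_gt (div_pos (D.len_pos g) (D.len_pos (g + e)))
      (Real.pi * stair (D.len g) (x - D.blow (D.angle g)) / D.len g)
    rw [gapTermSlope]
    linarith
  · push Not at h
    simp [h]

lemma shift_regular (hr : r ∈ Ioo (0 : ℝ) 1) (hC : 0 ≤ C) (hκ : 0 < κ) (hκ₁ : κ ≤ 1)
    (hκe : ∀ g, κ ≤ D.len g / D.len (g + e))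
    (hCe : ∀ g, |1 - (D.len g / D.len (g + e)) ^ 2| ≤ C * D.len g ^ r) :
    IsCircleDiffeoLift (D.shift e) ∧ OmegaCont (fun t => t ^ r) (deriv (D.shift e)) := by
  have hd := D.hasDerivAt_shift hr hC hκ hκ₁ hκe hCe
  have hderiv : deriv (D.shift e) = fun x => 1 + ∑' g, D.gapTermSlope e g x :=
    funext fun x => (hd x).deriv
  have hpos : ∀ x, 0 < deriv (D.shift e) x := fun x => by
    rw [hderiv]
    exact D.one_add_tsum_gapTermSlope_pos e x
  have hbd : ∀ x y, |deriv (D.shift e) x - deriv (D.shift e) y| ≤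
      2 * (C * Real.pi ^ r / κ ^ 4) * |x - y| ^ r := fun x y => by
    simp only [hderiv, add_sub_add_left_eq_sub]
    exact abs_tsum_sub_tsum_le_of_disjoint (by positivity)
      (D.abs_gapTermSlope_sub_le hr hκ hκ₁ hκe hCe) (D.gapTermSlope_disjoint e) x y
  refine ⟨⟨strictMono_of_deriv_pos hpos, D.shift_add_one e, ?_, hpos⟩, _, fun x y _ => hbd x y⟩
  refine contDiff_one_iff_deriv.2 ⟨fun x => (hd x).differentiableAt, ?_⟩
  refine continuous_iff_continuousAt.2 fun x => ?_
  rw [ContinuousAt, tendsto_iff_norm_sub_tendsto_zero]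
  refine squeeze_zero (fun _ => norm_nonneg _) (fun y => hbd y x) ?_
  have : ContinuousAt (fun y : ℝ => 2 * (C * Real.pi ^ r / κ ^ 4) * |y - x| ^ r) x :=
    continuousAt_const.mul (ContinuousAt.rpow_const (by fun_prop) (Or.inr hr.1.le))
  simpa [ContinuousAt, Real.zero_rpow hr.1.ne'] using this

end Regularity

lemma iterate_shift_blow (e : G) (y : ℝ) (n : ℕ) :
    (D.shift e)^[n] (D.blow y) = D.blow (y + n * D.angle e) := by
  induction n with
  | zero => simp
  | succ n ih =>
    rw [Function.iterate_succ_apply', ih, shift_blow]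
    congr 1
    push_cast
    ring

lemma abs_blow_sub_le (y : ℝ) : |D.blow y - y| ≤ 1 := by
  have h1 := D.blow_strictMono.monotone (Int.floor_le y)
  have h2 := D.blow_strictMono.monotone (Int.lt_floor_add_one y).le
  have h3 : D.blow (⌊y⌋ + 1) = ⌊y⌋ + 1 := by exact_mod_cast D.blow_int (⌊y⌋ + 1)
  rw [D.blow_int] at h1
  rw [h3] at h2
  have := Int.floor_le y
  have := Int.lt_floor_add_one y
  rw [abs_le]
  constructor <;> linarith

lemma hasRotationNumber_shift (e : G) : HasRotationNumber (D.shift e) (D.angle e) := by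
  rw [HasRotationNumber, tendsto_iff_norm_sub_tendsto_zero]
  refine squeeze_zero' (Eventually.of_forall fun _ => norm_nonneg _) ?_
    tendsto_one_div_atTop_nhds_zero_nat
  filter_upwards [eventually_gt_atTop 0] with n hn
  have hn' : (0 : ℝ) < n := by exact_mod_cast hn
  have h := D.iterate_shift_blow e 0 n
  rw [D.blow_zero, zero_add] at h
  rw [h, show D.blow (n * D.angle e) / n - D.angle e =
    (D.blow (n * D.angle e) - n * D.angle e) / n by field_simp, norm_div, Real.norm_natCast]
  gcongr
  exact D.abs_blow_sub_le _

lemma eq_zero_of_blow_mem {y : ℝ} (h₀ : 0 ≤ D.blow y) (h₁ : D.blow y < D.len 0) : y = 0 := by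
  rcases lt_trichotomy y 0 with h | h | h
  · have := D.blow_strictMono h
    rw [D.blow_zero] at this
    linarith
  · exact h
  · have h2 := D.blowRight_lt_blow h
    have h3 := D.blowRight_angle_add_int 0 0
    simp only [map_zero, Int.cast_zero, add_zero, D.blow_zero] at h3
    linarith

lemma exists_small_multiple (β : ℝ) {δ : ℝ} (hδ : 0 < δ) :
    ∃ (n : ℕ) (m : ℤ), 0 < n ∧ 0 ≤ n * β + m ∧ n * β + m < δ := by
  obtain ⟨N, hN⟩ := exists_nat_one_div_lt (lt_min hδ one_pos)
  obtain ⟨k, hk, -, hkN⟩ := Real.exists_nat_abs_mul_sub_round_le β N.succ_pos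
  have hlt : |k * β - round (k * β)| < min δ 1 := by
    refine (hkN.trans ?_).trans_lt hN
    push_cast
    gcongr
    linarith
  obtain ⟨hlt₁, hlt₂⟩ := lt_min_iff.1 hlt
  rcases le_or_gt 0 (k * β - round (k * β)) with h | h
  · refine ⟨k, -round (k * β), hk, ?_, ?_⟩ <;> rw [abs_of_nonneg h] at hlt₁ <;> push_cast <;>
      linarith
  · rw [abs_of_neg h] at hlt₁ hlt₂
    set ε := -(k * β - round (k * β)) with hε
    have hε₀ : 0 < ε := by linarith
    have h1 := Nat.floor_le (one_div_pos.2 hε₀).le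
    have h2 := Nat.lt_floor_add_one (1 / ε)
    rw [le_div_iff₀ hε₀] at h1
    rw [div_lt_iff₀ hε₀] at h2
    have h3 : 0 < ⌊1 / ε⌋₊ := Nat.floor_pos.2 ((one_le_div hε₀).2 hlt₂.le)
    have h4 : ((⌊1 / ε⌋₊ * k : ℕ) : ℝ) * β + ((1 - ⌊1 / ε⌋₊ * round (k * β) : ℤ) : ℝ) =
        1 - ⌊1 / ε⌋₊ * ε := by
      rw [hε]
      push_cast
      ring
    refine ⟨⌊1 / ε⌋₊ * k, 1 - ⌊1 / ε⌋₊ * round (k * β), Nat.mul_pos h3 hk, ?_, ?_⟩ <;>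
      rw [h4] <;> linarith

lemma shift_not_conj_rotation (e : G) (he : ∀ n : ℕ, 0 < n → n • e ≠ 0)
    {h : ℝ → ℝ} (hh : IsCircleHomeoLift h)
    {β : ℝ} (hβ : ∀ x, h (D.shift e x) = h x + β) : False := by
  obtain ⟨-, hmono, hone⟩ := hh
  have hadd : ∀ x (m : ℤ), h (x + m) = h x + m := fun x m =>
    CircleDeg1Lift.map_add_int ⟨⟨h, hmono.monotone⟩, hone⟩ x m
  obtain ⟨n, m, hn, h0, h1⟩ := exists_small_multiple β (sub_pos.2 (hmono (D.len_pos 0)))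
  have hit : ∀ n : ℕ, h ((D.shift e)^[n] 0) = h 0 + n * β := fun n => by
    induction n with
    | zero => simp
    | succ n ih =>
      rw [Function.iterate_succ_apply', hβ, ih]
      push_cast
      ring
  have hb := D.iterate_shift_blow e 0 n
  rw [D.blow_zero, zero_add] at hb
  have hval := hadd ((D.shift e)^[n] 0) m
  rw [hit, hb, ← D.blow_add_int] at hval
  have hz := D.eq_zero_of_blow_mem (y := n * D.angle e + m)
    (hmono.le_iff_le.1 (by linarith)) (hmono.lt_iff_lt.1 (by linarith))
  refine he n hn (D.free _ (-m) ?_)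
  rw [map_nsmul, nsmul_eq_mul]
  push_cast
  linarith

end DenjoyData

lemma summable_prod_apply_of_nonneg {ι β : Type*} [Fintype ι] {f : β → ℝ} (hf : ∀ b, 0 ≤ f b)
    (hs : Summable f) : Summable fun g : ι → β => ∏ k, f (g k) := by
  classical
  refine summable_of_sum_le (c := ∏ _k : ι, ∑' b, f b) (fun g => Finset.prod_nonneg fun k _ => hf _)
    fun u => ?_
  calc ∑ g ∈ u, ∏ k, f (g k)
      ≤ ∑ g ∈ Fintype.piFinset fun k => u.image fun g => g k, ∏ k, f (g k) := by
        refine Finset.sum_le_sum_of_subset_of_nonneg (fun g hg => ?_)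
          fun g _ _ => Finset.prod_nonneg fun k _ => hf _
        exact Fintype.mem_piFinset.2 fun k => Finset.mem_image_of_mem (fun g => g k) hg
    _ = ∏ k, ∑ b ∈ u.image fun g => g k, f b := (Finset.prod_univ_sum _ _).symm
    _ ≤ _ := Finset.prod_le_prod (fun k _ => Finset.sum_nonneg fun b _ => hf b)
        fun k _ => hs.sum_le_tsum _ fun b _ => hf b

lemma summable_one_add_abs_int_rpow {b : ℝ} (hb : 1 < b) :
    Summable fun n : ℤ => (1 + |(n : ℝ)|) ^ (-b) := by
  refine ((Real.summable_abs_int_rpow hb).add (hasSum_pi_single (0 : ℤ) (1 : ℝ)).summable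
    ).of_nonneg_of_le (fun n => by positivity) fun n => ?_
  by_cases hn : n = 0
  · subst hn
    simpa using Real.rpow_nonneg le_rfl (-b)
  · have h1 : (0 : ℝ) < |(n : ℝ)| := by positivity
    rw [Pi.single_eq_of_ne hn, add_zero]
    exact Real.rpow_le_rpow_of_nonpos h1 (by linarith) (by linarith)

lemma rpow_sub_rpow_le {x y p : ℝ} (hx : 0 ≤ x) (hy : 0 < y) (hp : 1 ≤ p) :
    y ^ p - x ^ p ≤ p * y ^ (p - 1) * (y - x) := by
  have h := one_add_mul_self_le_rpow_one_add (s := x / y - 1)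
    (by linarith [div_nonneg hx hy.le]) hp
  rw [add_sub_cancel, Real.div_rpow hx hy.le, le_div_iff₀ (Real.rpow_pos_of_pos hy p)] at h
  rw [Real.rpow_sub_one hy.ne']
  have : p * (y ^ p / y) * (y - x) = y ^ p - (1 + p * (x / y - 1)) * y ^ p := by
    field_simp
    ring
  linarith

lemma abs_rpow_sub_rpow_le {x y p : ℝ} (hx : 1 ≤ x) (hy : 1 ≤ y) (hxy : |y - x| ≤ 1)
    (hp : 1 ≤ p) : |y ^ p - x ^ p| ≤ p * 2 ^ (p - 1) * x ^ (p - 1) := by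
  obtain ⟨h1, h2⟩ := abs_le.1 hxy
  have key : ∀ z, 0 ≤ z → z ≤ 2 * x → p * z ^ (p - 1) ≤ p * 2 ^ (p - 1) * x ^ (p - 1) :=
    fun z hz hzx => by
      rw [mul_assoc, ← Real.mul_rpow (by norm_num) (by linarith)]
      gcongr
  rw [abs_le]
  constructor
  · have h3 := rpow_sub_rpow_le (show 0 ≤ y by linarith) (show 0 < x by linarith) hp
    have h4 : p * x ^ (p - 1) * (x - y) ≤ p * x ^ (p - 1) :=
      mul_le_of_le_one_right (by positivity) (by linarith)
    linarith [key x (by linarith) (by linarith)]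
  · have h3 := rpow_sub_rpow_le (show 0 ≤ x by linarith) (show 0 < y by linarith) hp
    have h4 : p * y ^ (p - 1) * (y - x) ≤ p * y ^ (p - 1) :=
      mul_le_of_le_one_right (by positivity) (by linarith)
    linarith [key y (by linarith) (by linarith)]

/-- The inverse of the length, up to scaling, of the gap of index `g`. -/
noncomputable def gapWeight {d : ℕ} (τ : Fin d → ℝ) (g : Fin d → ℤ) : ℝ :=
  ∑ k, (1 + |(g k : ℝ)|) ^ (1 / τ k)

section GapWeight

variable {d : ℕ} {τ : Fin d → ℝ}

lemma one_add_abs_le_gapWeight_rpow (hτ : ∀ k, τ k ∈ Ioo (0 : ℝ) 1) (g : Fin d → ℤ) (k : Fin d) :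
    1 + |(g k : ℝ)| ≤ gapWeight τ g ^ τ k := by
  have h : (1 + |(g k : ℝ)|) ^ (1 / τ k) ≤ gapWeight τ g :=
    Finset.single_le_sum (f := fun k => (1 + |(g k : ℝ)|) ^ (1 / τ k))
      (fun k _ => by positivity) (Finset.mem_univ k)
  have h2 := Real.rpow_le_rpow (by positivity) h (hτ k).1.le
  rwa [← Real.rpow_mul (by positivity), one_div_mul_cancel (hτ k).1.ne', Real.rpow_one] at h2

lemma one_le_gapWeight (hd : 0 < d) (hτ : ∀ k, τ k ∈ Ioo (0 : ℝ) 1) (g : Fin d → ℤ) :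
    1 ≤ gapWeight τ g := by
  have h : (1 + |(g ⟨0, hd⟩ : ℝ)|) ^ (1 / τ ⟨0, hd⟩) ≤ gapWeight τ g :=
    Finset.single_le_sum (f := fun k => (1 + |(g k : ℝ)|) ^ (1 / τ k))
      (fun k _ => by positivity) (Finset.mem_univ _)
  refine le_trans (Real.one_le_rpow ?_ ?_) h
  · linarith [abs_nonneg (g ⟨0, hd⟩ : ℝ)]
  · exact (one_div_pos.2 (hτ _).1).le

lemma summable_inv_gapWeight (hd : 0 < d) (hτ : ∀ k, τ k ∈ Ioo (0 : ℝ) 1)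
    (hτsum : ∑ k, τ k < 1) : Summable fun g => (gapWeight τ g)⁻¹ := by
  have hσ : 0 < ∑ k, τ k :=
    Finset.sum_pos (fun k _ => (hτ k).1) ⟨⟨0, hd⟩, Finset.mem_univ _⟩
  refine (summable_prod_apply_of_nonneg (ι := Fin d) (fun n => by positivity)
    (summable_one_add_abs_int_rpow ((one_lt_div hσ).2 hτsum))).of_nonneg_of_le
    (fun g => inv_nonneg.2 (by linarith [one_le_gapWeight hd hτ g])) fun g => ?_
  have hW : 0 < gapWeight τ g := one_pos.trans_le (one_le_gapWeight hd hτ g)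
  have h : ∏ k, (1 + |(g k : ℝ)|) ≤ gapWeight τ g ^ ∑ k, τ k := by
    rw [Real.rpow_sum_of_pos hW]
    exact Finset.prod_le_prod (fun k _ => by positivity)
      fun k _ => one_add_abs_le_gapWeight_rpow hτ g k
  have hP : 0 < ∏ k, (1 + |(g k : ℝ)|) := Finset.prod_pos fun k _ => by positivity
  rw [Real.finsetProd_rpow _ _ fun k _ => by positivity]
  refine le_trans (le_of_eq ?_) (Real.rpow_le_rpow_of_nonpos hP h
    (neg_nonpos.2 (one_div_pos.2 hσ).le))
  rw [← Real.rpow_mul hW.le, mul_neg, mul_one_div_cancel hσ.ne', Real.rpow_neg_one]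

lemma abs_gapWeight_sub_le (hτ : ∀ k, τ k ∈ Ioo (0 : ℝ) 1) {g h : Fin d → ℤ} (k : Fin d)
    (hne : ∀ j, j ≠ k → h j = g j) (hk : |h k - g k| ≤ 1) :
    |gapWeight τ h - gapWeight τ g| ≤
      1 / τ k * 2 ^ (1 / τ k - 1) * gapWeight τ g ^ (1 - τ k) := by
  have hτk := (hτ k).1
  have hp : 1 ≤ 1 / τ k := (one_le_div hτk).2 (hτ k).2.le
  have h1 : gapWeight τ h - gapWeight τ g =
      (1 + |(h k : ℝ)|) ^ (1 / τ k) - (1 + |(g k : ℝ)|) ^ (1 / τ k) := by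
    rw [gapWeight, gapWeight, ← Finset.sum_sub_distrib]
    refine Finset.sum_eq_single k (fun j _ hj => ?_) (by simp)
    rw [hne j hj, sub_self]
  have hk' : |(h k : ℝ) - g k| ≤ 1 := by exact_mod_cast hk
  rw [h1]
  refine (abs_rpow_sub_rpow_le (by simp) (by simp) ?_ hp).trans ?_
  · rw [add_sub_add_left_eq_sub]
    exact (abs_abs_sub_abs_le_abs_sub _ _).trans hk'
  · have hW : 0 ≤ gapWeight τ g := Finset.sum_nonneg fun k _ => by positivity
    rw [show 1 - τ k = τ k * (1 / τ k - 1) by field_simp, Real.rpow_mul hW]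
    have := one_add_abs_le_gapWeight_rpow hτ g k
    gcongr

/-- The data for blowing up the orbit of `0` under the rotations of angles `α k`. -/
noncomputable def denjoyDataOfRatIndep (hd : 0 < d) {α : Fin d → ℝ} (hα : RatIndep α)
    (hτ : ∀ k, τ k ∈ Ioo (0 : ℝ) 1) (hτsum : ∑ k, τ k < 1) : DenjoyData (Fin d → ℤ) where
  angle := AddMonoidHom.mk' (fun g => ∑ k, (g k : ℝ) * α k) fun g h => by
    simp [add_mul, Finset.sum_add_distrib]
  len g := (1 + ∑' g, (gapWeight τ g)⁻¹)⁻¹ * (gapWeight τ g)⁻¹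
  len_pos g := by
    have hW : ∀ g, 0 < gapWeight τ g := fun g => one_pos.trans_le (one_le_gapWeight hd hτ g)
    have : 0 ≤ ∑' g, (gapWeight τ g)⁻¹ := tsum_nonneg fun g => (inv_pos.2 (hW g)).le
    have := hW g
    positivity
  summable_len := (summable_inv_gapWeight hd hτ hτsum).mul_left _
  tsum_len_lt_one := by
    have : 0 ≤ ∑' g, (gapWeight τ g)⁻¹ := tsum_nonneg fun g =>
      inv_nonneg.2 (by linarith [one_le_gapWeight hd hτ g])
    rw [tsum_mul_left, inv_mul_lt_one₀ (by linarith)]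
    linarith
  free g m h := by
    obtain ⟨-, h0⟩ := hα (fun k => g k) (-m) (by
      have : ∑ k, (g k : ℝ) * α k = m := h
      push_cast
      linarith)
    funext k
    exact_mod_cast h0 k

variable (hd : 0 < d) {α : Fin d → ℝ} (hα : RatIndep α)
    (hτ : ∀ k, τ k ∈ Ioo (0 : ℝ) 1) (hτsum : ∑ k, τ k < 1)

lemma denjoyDataOfRatIndep_angle_single (k : Fin d) :
    (denjoyDataOfRatIndep hd hα hτ hτsum).angle (Pi.single k 1) = α k := by
  change ∑ j, ((Pi.single k 1 : Fin d → ℤ) j : ℝ) * α j = α k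
  rw [Finset.sum_eq_single k (fun j _ hj => by simp [hj]) (by simp)]
  simp

lemma denjoyDataOfRatIndep_shift_regular (k : Fin d) :
    IsCircleDiffeoLift ((denjoyDataOfRatIndep hd hα hτ hτsum).shift (Pi.single k 1)) ∧
      OmegaCont (fun t => t ^ τ k)
        (deriv ((denjoyDataOfRatIndep hd hα hτ hτsum).shift (Pi.single k 1))) := by
  have hτk := (hτ k).1
  have hW : ∀ g, 1 ≤ gapWeight τ g := one_le_gapWeight hd hτ
  have hS : 0 ≤ ∑' g, (gapWeight τ g)⁻¹ := tsum_nonneg fun g =>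
    inv_nonneg.2 (by linarith [hW g])
  obtain ⟨c, hc₀, hlen⟩ : ∃ c, 0 < c ∧
      ∀ g, (denjoyDataOfRatIndep hd hα hτ hτsum).len g = c * (gapWeight τ g)⁻¹ :=
    ⟨_, by positivity, fun _ => rfl⟩
  set A := 1 / τ k * 2 ^ (1 / τ k - 1) with hA
  have hA₀ : 0 < A := by positivity
  have hratio : ∀ g, (denjoyDataOfRatIndep hd hα hτ hτsum).len g /
      (denjoyDataOfRatIndep hd hα hτ hτsum).len (g + Pi.single k 1) =
      gapWeight τ (g + Pi.single k 1) / gapWeight τ g := fun g => by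
    have h1 := hW g
    have h2 := hW (g + Pi.single k 1)
    rw [hlen, hlen]
    field_simp
  have hdiff : ∀ g, |gapWeight τ (g + Pi.single k 1) - gapWeight τ g| ≤
      A * gapWeight τ g ^ (1 - τ k) := fun g =>
    abs_gapWeight_sub_le hτ k (fun j hj => by simp [hj]) (by simp)
  have hdiff' : ∀ g, |gapWeight τ g - gapWeight τ (g + Pi.single k 1)| ≤
      A * gapWeight τ (g + Pi.single k 1) ^ (1 - τ k) := fun g =>
    abs_gapWeight_sub_le hτ k (fun j hj => by simp [hj]) (by simp)
  have hpow : ∀ g, gapWeight τ g ^ (1 - τ k) ≤ gapWeight τ g := fun g => by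
    simpa using Real.rpow_le_rpow_of_exponent_le (hW g) (show 1 - τ k ≤ 1 by linarith)
  refine DenjoyData.shift_regular _ (hτ k) (C := A * (2 + A) * c ^ (-τ k)) (κ := (1 + A)⁻¹)
    (by positivity) (by positivity) (inv_le_one_of_one_le₀ (by linarith)) (fun g => ?_)
    fun g => ?_
  · have h1 := hW g
    have h2 := hW (g + Pi.single k 1)
    have h3 := (le_abs_self _).trans (hdiff' g)
    have h4 := mul_le_mul_of_nonneg_left (hpow (g + Pi.single k 1)) hA₀.le
    rw [hratio, le_div_iff₀ (by linarith), inv_mul_le_iff₀ (by linarith)]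
    linarith
  · have h1 := hW g
    have h2 := hW (g + Pi.single k 1)
    have h3 := (le_abs_self _).trans (hdiff g)
    have h4 := mul_le_mul_of_nonneg_left (hpow g) hA₀.le
    rw [hratio, hlen, Real.mul_rpow hc₀.le (by positivity), Real.inv_rpow (by positivity)]
    have h5 : gapWeight τ (g + Pi.single k 1) / gapWeight τ g ≤ 1 + A := by
      rw [div_le_iff₀ (by linarith)]
      linarith
    have h6 : |1 - gapWeight τ (g + Pi.single k 1) / gapWeight τ g| ≤
        A * (gapWeight τ g ^ τ k)⁻¹ := by
      rw [← abs_neg, neg_sub, div_sub_one (by linarith), abs_div,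
        abs_of_pos (by linarith : 0 < gapWeight τ g),
        div_le_iff₀ (by linarith)]
      refine (hdiff g).trans_eq ?_
      rw [Real.rpow_sub (by linarith), Real.rpow_one]
      ring
    have h7 : 0 ≤ gapWeight τ (g + Pi.single k 1) / gapWeight τ g := by positivity
    rw [show 1 - (gapWeight τ (g + Pi.single k 1) / gapWeight τ g) ^ 2 =
      (1 - gapWeight τ (g + Pi.single k 1) / gapWeight τ g) *
      (1 + gapWeight τ (g + Pi.single k 1) / gapWeight τ g) by ring, abs_mul,
      abs_of_nonneg (by linarith :
        0 ≤ 1 + gapWeight τ (g + Pi.single k 1) / gapWeight τ g)]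
    calc _ ≤ A * (gapWeight τ g ^ τ k)⁻¹ * (2 + A) := by
          refine mul_le_mul h6 (by linarith) (by linarith) ?_
          exact (abs_nonneg _).trans h6
      _ = _ := by
          have : c ^ τ k ≠ 0 := (Real.rpow_pos_of_pos hc₀ _).ne'
          rw [Real.rpow_neg hc₀.le]
          field_simp

end GapWeight

/-- Theorem (Kleptsyn–Navas, converse part): if `τ₁ + ⋯ + τ_d < 1` and
`α₁, …, α_d` are independent over the rationals, there exist commuting
`C^{1+τ_k}` circle diffeomorphisms with rotation numbers `α_k` which are not
simultaneously topologically conjugate to rotations. -/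
theorem exists_commuting_holder_diffeos_not_conjugate
    {d : ℕ} (hd : 2 ≤ d) (α : Fin d → ℝ) (hindep : RatIndep α)
    (τ : Fin d → ℝ) (hτ : ∀ k, τ k ∈ Ioo (0 : ℝ) 1) (hτsum : ∑ k, τ k < 1) :
    ∃ f : Fin d → ℝ → ℝ,
      (∀ k, IsCircleDiffeoLift (f k)) ∧
      (∀ k, OmegaCont (fun t => t ^ τ k) (deriv (f k))) ∧
      (∀ i j, ∀ x, f i (f j x) = f j (f i x)) ∧
      (∀ k, HasRotationNumber (f k) (α k)) ∧
      ¬ SimultaneouslyConjToRotations f := by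
  have hd₀ : 0 < d := by linarith
  refine ⟨fun k => (denjoyDataOfRatIndep hd₀ hindep hτ hτsum).shift (Pi.single k 1),
    fun k => (denjoyDataOfRatIndep_shift_regular hd₀ hindep hτ hτsum k).1,
    fun k => (denjoyDataOfRatIndep_shift_regular hd₀ hindep hτ hτsum k).2, fun i j x => ?_,
    fun k => ?_, ?_⟩
  · simp only
    rw [DenjoyData.shift_shift, DenjoyData.shift_shift, add_comm]
  · simpa only [denjoyDataOfRatIndep_angle_single] using
      (denjoyDataOfRatIndep hd₀ hindep hτ hτsum).hasRotationNumber_shift (Pi.single k 1)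
  · rintro ⟨h, hh, hconj⟩
    obtain ⟨β, hβ⟩ := hconj ⟨0, hd₀⟩
    refine DenjoyData.shift_not_conj_rotation _ _ (fun n hn hz => ?_) hh hβ
    have := congrFun hz ⟨0, hd₀⟩
    simp at this
    lia
end

section
/- Let d ≥ 2 be an integer, α₁, …, α_d ∈ (0,1), and ε₁, …, ε_d ≥ 0. Then the moduli of continuity ω_k(x) = x^{α_k}·(log(1/x))^{ε_k} (for x small, k = 1, …, d) are consistent: there exist strictly increasing sequences (X_{1,m}), …, (X_{d,m}) of positive integers and a constant C > 0 such that for each k ∈ {1,…,d} and all m, ω_k(1/∏_{j=1}^d X_{j,m}) ≤ C·∏_{j=1}^d ω_j(1/X_{k,m}). -/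
open Filter Set

/-- The modulus of continuity `x ↦ x^a · (log(1/x))^e` (meaningful for small `x > 0`). -/
noncomputable def holderLogModulus (a e : ℝ) (x : ℝ) : ℝ :=
  x ^ a * (Real.log (1 / x)) ^ e

theorem holderLogModulus_one_div {a e x : ℝ} (hx : 0 < x) :
    holderLogModulus a e (1 / x) = Real.exp (-(a * Real.log x)) * Real.log x ^ e := by
  rw [holderLogModulus, one_div_one_div, Real.rpow_def_of_pos (by positivity), one_div,
    Real.log_inv]
  congr 2
  ring

/-- Bounds for `x` and `log P` of the orders `exp (a t)` and `t` give the modulus inequality. -/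
theorem holderLogModulus_one_div_le_mul_prod {ι : Type*} [Fintype ι] {α ε : ι → ℝ}
    (hα : ∀ j, 0 < α j) (hε : ∀ j, 0 ≤ ε j) (k : ι) {B t x P : ℝ} (ht : 1 ≤ t) (hP₀ : 0 < P)
    (hx₀ : 0 < x) (hx : α k * t ≤ Real.log x) (hx' : Real.log x ≤ α k * t + Real.log 2)
    (hP : (∑ j, α j) * t ≤ Real.log P) (hP' : Real.log P ≤ B * t) :
    holderLogModulus (α k) (ε k) (1 / P) ≤
      (Real.exp ((∑ j, α j) * Real.log 2) * B ^ ε k / α k ^ (∑ j, ε j)) *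
        ∏ j, holderLogModulus (α j) (ε j) (1 / x) := by
  have ht₀ : 0 < t := by linarith
  have hk := hα k
  have hA : 0 ≤ ∑ j, α j := Finset.sum_nonneg fun j _ => (hα j).le
  have hE : ε k ≤ ∑ j, ε j := Finset.single_le_sum (fun j _ => hε j) (Finset.mem_univ k)
  have hlogx : 0 < Real.log x := lt_of_lt_of_le (by positivity) hx
  have hlogP : 0 ≤ Real.log P := le_trans (by positivity) hP
  have hB : 0 ≤ B := nonneg_of_mul_nonneg_left (hlogP.trans hP') ht₀
  have hprod : ∏ j, holderLogModulus (α j) (ε j) (1 / x) =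
      Real.exp (-((∑ j, α j) * Real.log x)) * Real.log x ^ (∑ j, ε j) := by
    simp_rw [holderLogModulus_one_div hx₀]
    rw [Finset.prod_mul_distrib, ← Real.exp_sum, Real.rpow_sum_of_pos hlogx,
      Finset.sum_neg_distrib, Finset.sum_mul]
  rw [hprod, holderLogModulus_one_div hP₀]
  have hexp : Real.exp (-(α k * Real.log P)) ≤
      Real.exp ((∑ j, α j) * Real.log 2) * Real.exp (-((∑ j, α j) * Real.log x)) := by
    rw [← Real.exp_add, Real.exp_le_exp]
    nlinarith [mul_le_mul_of_nonneg_left hP hk.le, mul_le_mul_of_nonneg_left hx' hA]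
  have hlog : Real.log P ^ ε k ≤
      B ^ ε k / α k ^ (∑ j, ε j) * Real.log x ^ (∑ j, ε j) := by
    calc Real.log P ^ ε k ≤ (B * t) ^ ε k := Real.rpow_le_rpow hlogP hP' (hε k)
      _ = B ^ ε k * t ^ ε k := Real.mul_rpow hB ht₀.le
      _ ≤ B ^ ε k * t ^ (∑ j, ε j) := by gcongr
      _ = B ^ ε k / α k ^ (∑ j, ε j) * (α k * t) ^ (∑ j, ε j) := by
        rw [Real.mul_rpow hk.le ht₀.le]
        have := Real.rpow_pos_of_pos hk (∑ j, ε j)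
        field_simp
      _ ≤ _ := by
        gcongr
        exact (hε k).trans hE
  calc _ ≤ _ := mul_le_mul hexp hlog (Real.rpow_nonneg hlogP _) (by positivity)
    _ = _ := by ring

theorem Nat.ceil_exp_lt_ceil_exp {x y : ℝ} (hx : 0 ≤ x) (hxy : x + 1 ≤ y) :
    ⌈Real.exp x⌉₊ < ⌈Real.exp y⌉₊ := by
  have h₁ : (⌈Real.exp x⌉₊ : ℝ) < Real.exp x + 1 := Nat.ceil_lt_add_one (Real.exp_pos x).le
  have h₂ : Real.exp x * Real.exp 1 ≤ Real.exp y := by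
    rw [← Real.exp_add]
    exact Real.exp_le_exp.2 hxy
  have h₃ : (2 : ℝ) ≤ Real.exp 1 := by linarith [Real.add_one_le_exp (1 : ℝ)]
  have h₄ : Real.exp y ≤ (⌈Real.exp y⌉₊ : ℝ) := Nat.le_ceil _
  have h₅ : 1 ≤ Real.exp x := Real.one_le_exp hx
  have : (⌈Real.exp x⌉₊ : ℝ) < ⌈Real.exp y⌉₊ := by nlinarith
  exact_mod_cast this

theorem Real.le_log_ceil_exp (x : ℝ) : x ≤ Real.log ⌈Real.exp x⌉₊ := by
  rw [Real.le_log_iff_exp_le (by exact_mod_cast Nat.ceil_pos.2 (Real.exp_pos x))]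
  exact Nat.le_ceil _

theorem Real.log_ceil_exp_le {x : ℝ} (hx : 0 ≤ x) :
    Real.log ⌈Real.exp x⌉₊ ≤ x + Real.log 2 := by
  have h₁ := Nat.ceil_lt_add_one (Real.exp_pos x).le
  have h₂ : 1 ≤ Real.exp x := Real.one_le_exp hx
  rw [Real.log_le_iff_le_exp (by exact_mod_cast Nat.ceil_pos.2 (Real.exp_pos x)),
    Real.exp_add, Real.exp_log two_pos]
  linarith

/-- Proposition: the moduli `ω_k(x) = x^{α_k} (log(1/x))^{ε_k}` with `α_k ∈ (0,1)`,
`ε_k ≥ 0` are consistent: there are strictly increasing sequences of positive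
integers `X_{k,m}` and a constant `C > 0` such that for each `k` and all `m`,
`ω_k(1/∏_j X_{j,m}) ≤ C · ∏_j ω_j(1/X_{k,m})`. -/
theorem holderLog_moduli_consistent
    {d : ℕ} (hd : 2 ≤ d) (α ε : Fin d → ℝ)
    (hα : ∀ k, α k ∈ Ioo (0 : ℝ) 1) (hε : ∀ k, 0 ≤ ε k) :
    ∃ (X : Fin d → ℕ → ℕ) (C : ℝ), 0 < C ∧ (∀ k, StrictMono (X k)) ∧
      (∀ k m, 1 ≤ X k m) ∧
      ∀ (k : Fin d) (m : ℕ),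
        holderLogModulus (α k) (ε k) (1 / ∏ j, (X j m : ℝ))
          ≤ C * ∏ j, holderLogModulus (α j) (ε j) (1 / (X k m : ℝ)) := by
  have hα₀ : ∀ k, 0 < α k := fun k => (hα k).1
  set M : ℝ := ∑ j, (α j)⁻¹
  have hM : ∀ k, (α k)⁻¹ ≤ M := fun k =>
    Finset.single_le_sum (fun j _ => (inv_pos.2 (hα₀ j)).le) (Finset.mem_univ k)
  have hαM : ∀ k, 1 ≤ α k * M := fun k => by
    rw [← mul_inv_cancel₀ (hα₀ k).ne']
    exact mul_le_mul_of_nonneg_left (hM k) (hα₀ k).le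
  have hM₁ : 1 ≤ M := (one_le_inv₀ (hα₀ ⟨0, by omega⟩)).2 (hα ⟨0, by omega⟩).2.le |>.trans (hM _)
  set t : ℕ → ℝ := fun m => M * (m + 1)
  have ht : ∀ m, 1 ≤ t m := fun m => one_le_mul_of_one_le_of_one_le hM₁ (by simp)
  have hαt : ∀ k m, 0 ≤ α k * t m := fun k m =>
    mul_nonneg (hα₀ k).le (zero_le_one.trans (ht m))
  set X : Fin d → ℕ → ℕ := fun k m => ⌈Real.exp (α k * t m)⌉₊
  have hX : ∀ k m, 0 < X k m := fun k m => Nat.ceil_pos.2 (Real.exp_pos _)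
  have hX₀ : ∀ k m, (0 : ℝ) < X k m := fun k m => by exact_mod_cast hX k m
  set A : ℝ := ∑ j, α j
  have hA : 0 < A := Finset.sum_pos (fun j _ => hα₀ j) ⟨⟨0, by omega⟩, Finset.mem_univ _⟩
  set B : ℝ := A + d * Real.log 2
  have hB : 0 < B := by positivity
  set c : Fin d → ℝ := fun k => Real.exp (A * Real.log 2) * B ^ ε k / α k ^ (∑ j, ε j)
  have hc : ∀ k, 0 < c k := fun k =>
    div_pos (mul_pos (Real.exp_pos _) (Real.rpow_pos_of_pos hB _))
      (Real.rpow_pos_of_pos (hα₀ k) _)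
  refine ⟨X, ∑ k, c k, Finset.sum_pos (fun k _ => hc k) ⟨⟨0, by omega⟩, Finset.mem_univ _⟩,
    fun k => strictMono_nat_of_lt_succ fun m => ?_, hX, fun k m => ?_⟩
  · refine Nat.ceil_exp_lt_ceil_exp (hαt k m) ?_
    simp only [t]
    push_cast
    linarith [hαM k]
  · have hlogP : Real.log (∏ j, (X j m : ℝ)) = ∑ j, Real.log (X j m) :=
      Real.log_prod fun j _ => (hX₀ j m).ne'
    have hP : A * t m ≤ Real.log (∏ j, (X j m : ℝ)) := by
      rw [hlogP, Finset.sum_mul]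
      exact Finset.sum_le_sum fun j _ => Real.le_log_ceil_exp _
    have hP' : Real.log (∏ j, (X j m : ℝ)) ≤ B * t m := by
      calc _ ≤ ∑ j, (α j * t m + Real.log 2) := by
            rw [hlogP]
            exact Finset.sum_le_sum fun j _ => Real.log_ceil_exp_le (hαt j m)
        _ = A * t m + d * Real.log 2 := by
            simp [Finset.sum_add_distrib, ← Finset.sum_mul, A]
        _ ≤ B * t m := by
            have : 0 ≤ d * Real.log 2 := by positivity
            nlinarith [ht m]
    refine (holderLogModulus_one_div_le_mul_prod hα₀ hε k (ht m)
      (Finset.prod_pos fun j _ => hX₀ j m) (hX₀ k m) (Real.le_log_ceil_exp _)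
      (Real.log_ceil_exp_le (hαt k m)) hP hP').trans ?_
    refine mul_le_mul_of_nonneg_right
      (Finset.single_le_sum (fun j _ => (hc j).le) (Finset.mem_univ k)) ?_
    refine Finset.prod_nonneg fun j _ => ?_
    rw [holderLogModulus_one_div (hX₀ k m)]
    exact mul_nonneg (Real.exp_pos _).le
      (Real.rpow_nonneg ((hαt k m).trans (Real.le_log_ceil_exp _)) _)
end
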